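/- arXiv:2509.05997 — 7 statements merged into one kernel-verified Lean document; each statement's English description precedes it below -/
import Mathlib

section
/- Let (U, d) be a metric space, let P ⊆ U be a finite set with at least two points, and let ε ∈ (0,1). Then there exists a (1/ε)-WSPD W of P such that every (33/ε)-WSPD W' of P satisfies |W'| ≥ |W|/7. In particular, P admits a (1/ε)-WSPD whose size is at most 7 times the size of the smallest (33/ε)-WSPD of P. -/
open Metric Set

variable {U : Type*} [MetricSpace U]

/-- The minimum distance between two sets: `d(A,B) = min_{a ∈ A, b ∈ B} d(a,b)`. -/
noncomputable def distSets (A B : Set U) : ℝ :=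
  sInf {t | ∃ a ∈ A, ∃ b ∈ B, t = dist a b}

/-- The pair `{A, B}` is `s`-separated: `max(diam A, diam B) ≤ (1/s) · d(A,B)`. -/
def WellSep (s : ℝ) (A B : Set U) : Prop :=
  max (Metric.diam A) (Metric.diam B) ≤ (1 / s) * distSets A B

/-- `W` is an `s`-WSPD of `P`: a finite family of pairs of nonempty disjoint subsets
of `P`, each pair `s`-separated, covering every pair of distinct points of `P`. -/
def IsWSPD (s : ℝ) (P : Set U) (W : Finset (Set U × Set U)) : Prop :=
  (∀ pr ∈ W, pr.1 ⊆ P ∧ pr.2 ⊆ P ∧ pr.1.Nonempty ∧ pr.2.Nonempty ∧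
      Disjoint pr.1 pr.2 ∧ WellSep s pr.1 pr.2) ∧
  ∀ x ∈ P, ∀ y ∈ P, x ≠ y →
    ∃ pr ∈ W, (x ∈ pr.1 ∧ y ∈ pr.2) ∨ (x ∈ pr.2 ∧ y ∈ pr.1)

lemma exists_maximal_indep {α : Type*} (R : α → α → Prop) (hrefl : ∀ a, R a a)
    (hsymm : ∀ a b, R a b → R b a) (T : Finset α) :
    ∃ S ⊆ T, (∀ p ∈ S, ∀ q ∈ S, R p q → p = q) ∧ ∀ t ∈ T, ∃ p ∈ S, R p t := by
  classical
  induction T using Finset.induction_on with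
  | empty => exact ⟨∅, by simp, by simp, by simp⟩
  | insert a T ha ih =>
    obtain ⟨S, hST, hind, hcov⟩ := ih
    by_cases h : ∃ p ∈ S, R p a
    · refine ⟨S, hST.trans (Finset.subset_insert _ _), hind, ?_⟩
      intro t ht
      rcases Finset.mem_insert.1 ht with rfl | ht
      · exact h
      · exact hcov t ht
    · push Not at h
      refine ⟨insert a S, Finset.insert_subset_insert _ hST, ?_, ?_⟩
      · intro p hp q hq hR
        rcases Finset.mem_insert.1 hp with hpa | hp' <;>
          rcases Finset.mem_insert.1 hq with hqa | hq'
        · rw [hpa, hqa]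
        · exact absurd (hsymm _ _ (hpa ▸ hR)) (h q hq')
        · exact absurd (hqa ▸ hR) (h p hp')
        · exact hind p hp' q hq' hR
      · intro t ht
        rcases Finset.mem_insert.1 ht with rfl | ht
        · exact ⟨t, Finset.mem_insert_self _ _, hrefl t⟩
        · obtain ⟨p, hp, hR⟩ := hcov t ht
          exact ⟨p, Finset.mem_insert_of_mem hp, hR⟩

lemma distSets_le (A B : Set U) {a b : U} (ha : a ∈ A) (hb : b ∈ B) :
    distSets A B ≤ dist a b := by
  refine csInf_le ⟨0, ?_⟩ ⟨a, ha, b, hb, rfl⟩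
  rintro t ⟨x, -, y, -, rfl⟩
  exact dist_nonneg

lemma le_distSets (A B : Set U) (hA : A.Nonempty) (hB : B.Nonempty) (r : ℝ)
    (h : ∀ a ∈ A, ∀ b ∈ B, r ≤ dist a b) : r ≤ distSets A B := by
  obtain ⟨a, ha⟩ := hA
  obtain ⟨b, hb⟩ := hB
  refine le_csInf ⟨_, a, ha, b, hb, rfl⟩ ?_
  rintro t ⟨x, hx, y, hy, rfl⟩
  exact h x hx y hy

lemma wellSep_dist_le {ε : ℝ} (hε0 : 0 < ε) {A B : Set U} (hA : A.Finite) (hB : B.Finite)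
    (h : WellSep (33 / ε) A B) {x x' y y' u v : U} (hx : x ∈ A) (hx' : x' ∈ A)
    (hy : y ∈ B) (hy' : y' ∈ B) (hu : u ∈ A) (hv : v ∈ B) :
    dist x x' ≤ ε / 33 * dist u v ∧ dist y y' ≤ ε / 33 * dist u v := by
  unfold WellSep at h
  rw [one_div_div] at h
  have h1 := distSets_le A B hu hv
  have h2 : ε / 33 * distSets A B ≤ ε / 33 * dist u v := by gcongr
  exact ⟨((dist_le_diam_of_mem hA.isBounded hx hx').trans (le_max_left _ _)).trans (h.trans h2),
    ((dist_le_diam_of_mem hB.isBounded hy hy').trans (le_max_right _ _)).trans (h.trans h2)⟩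

/-- **Instance-optimal WSPD.** For any finite metric space `P` with at least two points
and `ε ∈ (0,1)`, there is a `(1/ε)`-WSPD `W` of `P` such that every `(33/ε)`-WSPD `W'`
of `P` satisfies `|W'| ≥ |W|/7`. -/
theorem instance_optimal_wspd (P : Set U) (hPfin : P.Finite) (hP2 : 2 ≤ P.ncard)
    (ε : ℝ) (hε0 : 0 < ε) (hε1 : ε < 1) :
    ∃ W : Finset (Set U × Set U), IsWSPD (1 / ε) P W ∧
      ∀ W' : Finset (Set U × Set U), IsWSPD (33 / ε) P W' → W.card ≤ 7 * W'.card := by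
  classical
  let c : ℝ := ε / 33
  have hc : 0 < c := by positivity
  have hcε : c = ε / 33 := rfl
  clear_value c
  let R : U × U → U × U → Prop := fun p q =>
    (dist p.1 q.1 ≤ c * dist p.1 p.2 ∧ dist p.2 q.2 ≤ c * dist p.1 p.2) ∧
    (dist p.1 q.1 ≤ c * dist q.1 q.2 ∧ dist p.2 q.2 ≤ c * dist q.1 q.2)
  have hrefl : ∀ p, R p p := by
    intro p
    have : 0 ≤ c * dist p.1 p.2 := by positivity
    simp only [R, dist_self]
    exact ⟨⟨this, this⟩, this, this⟩
  have hsymm : ∀ p q, R p q → R q p := by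
    intro p q h
    simp only [R] at h ⊢
    rw [dist_comm q.1 p.1, dist_comm q.2 p.2]
    exact ⟨h.2, h.1⟩
  obtain ⟨S, hST, hind, hcov⟩ := exists_maximal_indep R hrefl hsymm hPfin.toFinset.offDiag
  have hS : ∀ p ∈ S, p.1 ∈ P ∧ p.2 ∈ P ∧ p.1 ≠ p.2 := by
    intro p hp
    have := hST hp
    simpa [Finset.mem_offDiag] using this
  let F : U × U → Set U × Set U := fun p =>
    (P ∩ closedBall p.1 (c * dist p.1 p.2), P ∩ closedBall p.2 (c * dist p.1 p.2))
  refine ⟨S.image F, ⟨?_, ?_⟩, ?_⟩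
  · intro pr hpr
    obtain ⟨p, hp, rfl⟩ := Finset.mem_image.1 hpr
    obtain ⟨h1, h2, hne⟩ := hS p hp
    have hd : 0 < dist p.1 p.2 := dist_pos.2 hne
    have hr : 0 ≤ c * dist p.1 p.2 := by positivity
    have hn1 : (F p).1.Nonempty := ⟨p.1, h1, mem_closedBall_self hr⟩
    have hn2 : (F p).2.Nonempty := ⟨p.2, h2, mem_closedBall_self hr⟩
    have hfar : ∀ a ∈ (F p).1, ∀ b ∈ (F p).2, (1 - 2 * c) * dist p.1 p.2 ≤ dist a b := by
      rintro a ⟨-, ha⟩ b ⟨-, hb⟩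
      rw [mem_closedBall] at ha hb
      have h3 := dist_triangle4 p.1 a b p.2
      rw [dist_comm p.1 a] at h3
      linarith
    have hc1 : 2 * c < 1 := by linarith
    refine ⟨inter_subset_left, inter_subset_left, hn1, hn2, ?_, ?_⟩
    · rw [Set.disjoint_left]
      intro a ha hb
      have h4 := hfar a ha a hb
      rw [dist_self] at h4
      have : 0 < (1 - 2 * c) * dist p.1 p.2 := mul_pos (by linarith) hd
      linarith
    · have h5 := le_distSets _ _ hn1 hn2 _ hfar
      have hdm : ∀ z : U, diam (P ∩ closedBall z (c * dist p.1 p.2)) ≤ 2 * (c * dist p.1 p.2) :=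
        fun z => (diam_mono inter_subset_right isBounded_closedBall).trans (diam_closedBall hr)
      unfold WellSep
      rw [one_div_one_div]
      have h6 : 2 * (c * dist p.1 p.2) ≤ ε * distSets (F p).1 (F p).2 := by
        calc 2 * (c * dist p.1 p.2) = (2 * c) * dist p.1 p.2 := by ring
          _ ≤ (ε * (1 - 2 * c)) * dist p.1 p.2 := by
            refine mul_le_mul_of_nonneg_right ?_ hd.le
            rw [hcε]
            nlinarith
          _ = ε * ((1 - 2 * c) * dist p.1 p.2) := by ring
          _ ≤ _ := by gcongr
      exact max_le ((hdm _).trans h6) ((hdm _).trans h6)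
  · intro x hx y hy hxy
    obtain ⟨p, hp, hR⟩ := hcov (x, y) (by simp [Finset.mem_offDiag, hx, hy, hxy])
    refine ⟨F p, Finset.mem_image_of_mem _ hp, Or.inl ⟨⟨hx, ?_⟩, ⟨hy, ?_⟩⟩⟩
    · rw [mem_closedBall, dist_comm]; exact hR.1.1
    · rw [mem_closedBall, dist_comm]; exact hR.1.2
  · intro W' hW'
    obtain ⟨hW1, hW2⟩ := hW'
    have hex : ∀ p ∈ S, ∃ pr ∈ W' ∪ W'.image Prod.swap, p.1 ∈ pr.1 ∧ p.2 ∈ pr.2 := by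
      intro p hp
      obtain ⟨h1, h2, hne⟩ := hS p hp
      obtain ⟨pr, hpr, h | h⟩ := hW2 p.1 h1 p.2 h2 hne
      · exact ⟨pr, Finset.mem_union_left _ hpr, h⟩
      · exact ⟨pr.swap, Finset.mem_union_right _ (Finset.mem_image_of_mem _ hpr), h⟩
    have hsep : ∀ pr ∈ W' ∪ W'.image Prod.swap, pr.1.Finite ∧ pr.2.Finite ∧
        WellSep (33 / ε) pr.1 pr.2 := by
      intro pr hpr
      rcases Finset.mem_union.1 hpr with h | h
      · obtain ⟨ha, hb, -, -, -, hs⟩ := hW1 pr h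
        exact ⟨hPfin.subset ha, hPfin.subset hb, hs⟩
      · obtain ⟨q, hq, rfl⟩ := Finset.mem_image.1 h
        obtain ⟨ha, hb, -, -, -, hs⟩ := hW1 q hq
        refine ⟨hPfin.subset hb, hPfin.subset ha, ?_⟩
        have hsw : distSets q.2 q.1 = distSets q.1 q.2 := by
          unfold distSets
          congr 1
          ext t
          constructor
          · rintro ⟨a, ha, b, hb, rfl⟩
            exact ⟨b, hb, a, ha, dist_comm _ _⟩
          · rintro ⟨a, ha, b, hb, rfl⟩
            exact ⟨b, hb, a, ha, dist_comm _ _⟩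
        simp only [WellSep, Prod.fst_swap, Prod.snd_swap] at hs ⊢
        rw [hsw, max_comm]
        exact hs
    choose! f hf using hex
    have hcard : S.card ≤ (W' ∪ W'.image Prod.swap).card := by
      refine Finset.card_le_card_of_injOn f (fun p hp => (hf p hp).1) ?_
      intro p hp q hq hpq
      obtain ⟨hm, hp1, hp2⟩ := hf p hp
      obtain ⟨-, hq1, hq2⟩ := hf q hq
      rw [← hpq] at hq1 hq2
      obtain ⟨hfa, hfb, hs⟩ := hsep _ hm
      apply hind p hp q hq
      simp only [R, hcε]
      exact ⟨wellSep_dist_le hε0 hfa hfb hs hp1 hq1 hp2 hq2 hp1 hp2,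
        wellSep_dist_le hε0 hfa hfb hs hp1 hq1 hp2 hq2 hq1 hq2⟩
    have h1 : (S.image F).card ≤ S.card := Finset.card_image_le
    have h2 := Finset.card_union_le W' (W'.image Prod.swap)
    have h3 : (W'.image Prod.swap).card ≤ W'.card := Finset.card_image_le
    omega
end

section
/- Let (U, d) be a metric space, P ⊆ U finite, ε ∈ (0,1), r > 0, and let Q be an (r/2)-packing of P. Fix a nearest-neighbor map nn : P → Q (so d(p, nn(p)) = min_{q∈Q} d(p,q) for all p ∈ P), and for q ∈ Q let Vor(q) = {p ∈ P : nn(p) = q}. Suppose x, y ∈ P satisfy 4r/ε ≤ d(x,y) ≤ 8r/ε. Then: (i) 3r/ε ≤ d(nn(x), nn(y)) ≤ 9r/ε; (ii) x ∈ Vor(nn(x)), y ∈ Vor(nn(y)), and these two Voronoi cells are disjoint; (iii) diam(Vor(nn(x))) ≤ r and diam(Vor(nn(y))) ≤ r; (iv) d(Vor(nn(x)), Vor(nn(y))) ≥ 2r/ε; consequently the pair {Vor(nn(x)), Vor(nn(y))} is (1/ε)-separated. -/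
open Metric Set

variable {U : Type*} [MetricSpace U]

/-- The Voronoi cell of `q` in `P` with respect to the nearest-neighbor map `nn`:
all points of `P` whose nearest neighbor is `q`. -/
def vorCell (P : Set U) (nn : U → U) (q : U) : Set U := {p | p ∈ P ∧ nn p = q}

/-- Properties of Voronoi pairs induced by well-spread points of a packing:
if `Q` is an `(r/2)`-packing of `P`, `nn` is a nearest-neighbor map into `Q`, and
`x, y ∈ P` satisfy `4r/ε ≤ d(x,y) ≤ 8r/ε`, then (i) `3r/ε ≤ d(nn x, nn y) ≤ 9r/ε`;
(ii) `x ∈ Vor(nn x)`, `y ∈ Vor(nn y)` and these cells are disjoint;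
(iii) both cells have diameter at most `r`; (iv) the distance between the cells is
at least `2r/ε`; and consequently the pair of cells is `(1/ε)`-separated. -/
theorem voronoi_pair_well_separated
    (P Q : Set U) (hPfin : P.Finite) (hQP : Q ⊆ P)
    (ε r : ℝ) (hε0 : 0 < ε) (hε1 : ε < 1) (hr : 0 < r)
    (hcover : ∀ p ∈ P, ∃ q ∈ Q, dist p q < r / 2)
    (hpack : ∀ q ∈ Q, ∀ q' ∈ Q, q ≠ q' → r / 2 ≤ dist q q')
    (nn : U → U) (hnnQ : ∀ p ∈ P, nn p ∈ Q)
    (hnnmin : ∀ p ∈ P, ∀ q ∈ Q, dist p (nn p) ≤ dist p q)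
    (x y : U) (hx : x ∈ P) (hy : y ∈ P)
    (hxy₁ : 4 * r / ε ≤ dist x y) (hxy₂ : dist x y ≤ 8 * r / ε) :
    (3 * r / ε ≤ dist (nn x) (nn y) ∧ dist (nn x) (nn y) ≤ 9 * r / ε) ∧
    (x ∈ vorCell P nn (nn x) ∧ y ∈ vorCell P nn (nn y) ∧
      Disjoint (vorCell P nn (nn x)) (vorCell P nn (nn y))) ∧
    (Metric.diam (vorCell P nn (nn x)) ≤ r ∧ Metric.diam (vorCell P nn (nn y)) ≤ r) ∧
    (2 * r / ε ≤ distSets (vorCell P nn (nn x)) (vorCell P nn (nn y))) ∧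
    WellSep (1 / ε) (vorCell P nn (nn x)) (vorCell P nn (nn y)) := by
  have hd : ∀ p ∈ P, dist p (nn p) < r / 2 := by
    intro p hp
    obtain ⟨q, hq, h⟩ := hcover p hp
    exact (hnnmin p hp q hq).trans_lt h
  have hR : r < r / ε := by
    rw [lt_div_iff₀ hε0]; nlinarith
  have e2 : 2 * r / ε = 2 * (r / ε) := by ring
  have e3 : 3 * r / ε = 3 * (r / ε) := by ring
  have e4 : 4 * r / ε = 4 * (r / ε) := by ring
  have e8 : 8 * r / ε = 8 * (r / ε) := by ring
  have e9 : 9 * r / ε = 9 * (r / ε) := by ring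
  rw [e4] at hxy₁
  rw [e8] at hxy₂
  rw [e2, e3, e9]
  have hdx := hd x hx
  have hdy := hd y hy
  have h1 : 3 * (r / ε) ≤ dist (nn x) (nn y) := by
    have := dist_triangle4 x (nn x) (nn y) y
    rw [dist_comm (nn y) y] at this
    linarith
  have h2 : dist (nn x) (nn y) ≤ 9 * (r / ε) := by
    have := dist_triangle4 (nn x) x y (nn y)
    rw [dist_comm (nn x) x] at this
    linarith
  have hdiam : ∀ q, Metric.diam (vorCell P nn q) ≤ r := by
    intro q
    refine Metric.diam_le_of_forall_dist_le hr.le ?_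
    rintro a ⟨ha, haq⟩ b ⟨hb, hbq⟩
    have h3 := hd a ha
    have h4 := hd b hb
    rw [haq] at h3
    rw [hbq] at h4
    have := dist_triangle_right a b q
    linarith
  have hxm : x ∈ vorCell P nn (nn x) := ⟨hx, rfl⟩
  have hym : y ∈ vorCell P nn (nn y) := ⟨hy, rfl⟩
  have hsep : 2 * (r / ε) ≤ distSets (vorCell P nn (nn x)) (vorCell P nn (nn y)) := by
    refine le_csInf ⟨_, x, hxm, y, hym, rfl⟩ ?_
    rintro t ⟨a, ⟨ha, haq⟩, b, ⟨hb, hbq⟩, rfl⟩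
    have h3 := hd a ha
    have h4 := hd b hb
    rw [haq] at h3
    rw [hbq] at h4
    have := dist_triangle4 (nn x) a b (nn y)
    rw [dist_comm (nn x) a] at this
    linarith
  refine ⟨⟨h1, h2⟩, ⟨hxm, hym, ?_⟩, ⟨hdiam _, hdiam _⟩, hsep, ?_⟩
  · rw [Set.disjoint_left]
    rintro a ⟨_, ha⟩ ⟨_, hb⟩
    rw [← ha, ← hb, dist_self] at h1
    linarith
  · unfold WellSep
    rw [one_div_one_div]
    refine (max_le (hdiam _) (hdiam _)).trans ?_
    have h5 := mul_le_mul_of_nonneg_left hsep hε0.le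
    have h6 : ε * (2 * (r / ε)) = 2 * r := by field_simp
    linarith
end

section
/- Let (U, d) be a metric space, ε ∈ (0,1), r > 0, and let Q ⊆ U be a set in which any two distinct points are at distance ≥ r/2. Let x₁, y₁, x₂, y₂ ∈ Q with (x₁, y₁) ≠ (x₂, y₂) as ordered pairs and with d(x₁, y₁) ≤ 16r/ε. Then for any nonempty sets X, Y ⊆ U with x₁, x₂ ∈ X and y₁, y₂ ∈ Y, the pair {X, Y} is not (33/ε)-separated; more precisely, max(diam X, diam Y) > (ε/33)·d(X, Y). -/
open Metric Set

variable {U : Type*} [MetricSpace U]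

/-- No `(33/ε)`-separated pair can dominate two distinct pairs of points of a set `Q`
whose points are pairwise at distance at least `r/2`, provided the first pair spans
distance at most `16r/ε`: any sets `X ∋ x₁, x₂` and `Y ∋ y₁, y₂` satisfy
`max(diam X, diam Y) > (ε/33) · d(X,Y)`, so `{X,Y}` is not `(33/ε)`-separated. -/
theorem same_resolution_pairs_not_dominated
    (ε r : ℝ) (hε0 : 0 < ε) (hε1 : ε < 1) (hr : 0 < r)
    (Q : Set U) (hpack : ∀ a ∈ Q, ∀ b ∈ Q, a ≠ b → r / 2 ≤ dist a b)
    (x₁ y₁ x₂ y₂ : U) (hx₁ : x₁ ∈ Q) (hy₁ : y₁ ∈ Q) (hx₂ : x₂ ∈ Q) (hy₂ : y₂ ∈ Q)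
    (hne : (x₁, y₁) ≠ (x₂, y₂)) (hd : dist x₁ y₁ ≤ 16 * r / ε)
    (X Y : Set U) (hXfin : X.Finite) (hYfin : Y.Finite)
    (hXne : X.Nonempty) (hYne : Y.Nonempty)
    (hx₁X : x₁ ∈ X) (hx₂X : x₂ ∈ X) (hy₁Y : y₁ ∈ Y) (hy₂Y : y₂ ∈ Y) :
    (ε / 33) * distSets X Y < max (Metric.diam X) (Metric.diam Y) ∧
    ¬ WellSep (33 / ε) X Y := by
  have hlt : (ε / 33) * distSets X Y < max (Metric.diam X) (Metric.diam Y) := by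
    have h1 : distSets X Y ≤ dist x₁ y₁ := by
      apply csInf_le
      · refine ⟨0, ?_⟩
        rintro t ⟨a, _, b, _, rfl⟩
        exact dist_nonneg
      · exact ⟨x₁, hx₁X, y₁, hy₁Y, rfl⟩
    have h2 : (ε / 33) * distSets X Y ≤ (ε / 33) * (16 * r / ε) :=
      mul_le_mul_of_nonneg_left (h1.trans hd) (by positivity)
    have h3 : (ε / 33) * (16 * r / ε) = 16 * r / 33 := by
      field_simp
    have h4 : r / 2 ≤ max (Metric.diam X) (Metric.diam Y) := by
      by_cases hx : x₁ = x₂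
      · have hy : y₁ ≠ y₂ := fun h => hne (by rw [hx, h])
        exact ((hpack _ hy₁ _ hy₂ hy).trans
          (Metric.dist_le_diam_of_mem hYfin.isBounded hy₁Y hy₂Y)).trans (le_max_right _ _)
      · exact ((hpack _ hx₁ _ hx₂ hx).trans
          (Metric.dist_le_diam_of_mem hXfin.isBounded hx₁X hx₂X)).trans (le_max_left _ _)
    linarith
  refine ⟨hlt, fun h => ?_⟩
  unfold WellSep at h
  rw [one_div_div] at h
  exact absurd h (not_le.mpr hlt)
end

section
/- Let P ⊆ ℝ² be a finite set and let G be its weighted unit-distance graph. Let π_p be a path in G starting at a point p ∈ P and π_q a path in G starting at a point q ∈ P, and suppose there is a cell of Grid(1/8) that intersects both the polygonal curve traced by π_p and the polygonal curve traced by π_q. Then there is a path in G from p to q of length at most len(π_p) + len(π_q) + 1; in particular, if G is connected, d_G(p, q) ≤ len(π_p) + len(π_q) + 1. -/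
open Metric Set

/-- A path in the weighted unit-distance graph of `P`: a finite sequence of points
of `P` in which consecutive points are at distance at most `1`. -/
def IsUDPath {α : Type*} [MetricSpace α] (P : Set α) (m : ℕ) (f : Fin (m + 1) → α) : Prop :=
  (∀ i, f i ∈ P) ∧ ∀ i : Fin m, dist (f i.castSucc) (f i.succ) ≤ 1

/-- The length of a path: the sum of the lengths of its edges. -/
noncomputable def udLen {α : Type*} [MetricSpace α] (m : ℕ) (f : Fin (m + 1) → α) : ℝ :=
  ∑ i : Fin m, dist (f i.castSucc) (f i.succ)

/-- The weighted unit-distance graph of `P` is connected. -/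
def UDConnected {α : Type*} [MetricSpace α] (P : Set α) : Prop :=
  ∀ x ∈ P, ∀ y ∈ P, ∃ m, ∃ f : Fin (m + 1) → α,
    IsUDPath P m f ∧ f 0 = x ∧ f (Fin.last m) = y

/-- The shortest-path metric of the weighted unit-distance graph of `P`. -/
noncomputable def dG {α : Type*} [MetricSpace α] (P : Set α) (x y : α) : ℝ :=
  sInf {t | ∃ m, ∃ f : Fin (m + 1) → α,
    IsUDPath P m f ∧ f 0 = x ∧ f (Fin.last m) = y ∧ udLen m f = t}

/-- The cell of the grid of sidelength `1/8` indexed by `(a, b) ∈ ℤ²`: an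
axis-aligned half-open square. -/
def gridCell (a b : ℤ) : Set (EuclideanSpace ℝ (Fin 2)) :=
  {x | (a : ℝ) / 8 ≤ x 0 ∧ x 0 < ((a : ℝ) + 1) / 8 ∧
       (b : ℝ) / 8 ≤ x 1 ∧ x 1 < ((b : ℝ) + 1) / 8}

/-- The polygonal curve traced by a path: the union of its segments. -/
def udTrace (m : ℕ) (f : Fin (m + 1) → EuclideanSpace ℝ (Fin 2)) :
    Set (EuclideanSpace ℝ (Fin 2)) :=
  ⋃ i : Fin m, segment ℝ (f i.castSucc) (f i.succ)

/-- There is a path from `x` to `y` of length at most `L`. -/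
def UDReach {α : Type*} [MetricSpace α] (P : Set α) (L : ℝ) (x y : α) : Prop :=
  ∃ m, ∃ f : Fin (m + 1) → α,
    IsUDPath P m f ∧ f 0 = x ∧ f (Fin.last m) = y ∧ udLen m f ≤ L

theorem UDReach.mono {α : Type*} [MetricSpace α] {P : Set α} {L L' : ℝ} {x y : α}
    (h : UDReach P L x y) (hL : L ≤ L') : UDReach P L' x y := by
  obtain ⟨m, f, h1, h2, h3, h4⟩ := h
  exact ⟨m, f, h1, h2, h3, h4.trans hL⟩

theorem UDReach.snoc {α : Type*} [MetricSpace α] {P : Set α} {L : ℝ} {x y z : α}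
    (h : UDReach P L x y) (hz : z ∈ P) (hd : dist y z ≤ 1) :
    UDReach P (L + dist y z) x z := by
  obtain ⟨m, f, h1, h2, h3, h4⟩ := h
  have e1 : ∀ i : Fin m, (Fin.snoc f z : Fin (m + 2) → α) i.castSucc.succ = f i.succ := by
    intro i
    rw [Fin.succ_castSucc, Fin.snoc_castSucc (α := fun _ => α)]
  have e2 : (Fin.snoc f z : Fin (m + 2) → α) (Fin.last m).succ = z := by
    rw [Fin.succ_last, Fin.snoc_last (α := fun _ => α)]
  have e3 : ∀ i : Fin (m + 1), (Fin.snoc f z : Fin (m + 2) → α) i.castSucc = f i := by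
    intro i
    rw [Fin.snoc_castSucc (α := fun _ => α)]
  refine ⟨m + 1, (Fin.snoc f z : Fin (m + 2) → α), ⟨?_, ?_⟩, ?_, ?_, ?_⟩
  · intro i
    refine Fin.lastCases ?_ (fun i => ?_) i
    · rw [Fin.snoc_last (α := fun _ => α)]; exact hz
    · rw [e3]; exact h1.1 i
  · intro i
    refine Fin.lastCases ?_ (fun i => ?_) i
    · rw [e2, e3, h3]; exact hd
    · rw [e1, e3]; exact h1.2 i
  · rw [← h2, ← e3 0]; rfl
  · rw [Fin.snoc_last (α := fun _ => α)]
  · unfold udLen at h4 ⊢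
    rw [Fin.sum_univ_castSucc, e2, e3, h3]
    simp only [e1, e3]
    linarith

theorem udPath_init {α : Type*} [MetricSpace α] {P : Set α} {m : ℕ} {f : Fin (m + 2) → α}
    (h : IsUDPath P (m + 1) f) : IsUDPath P m (fun i => f i.castSucc) :=
  ⟨fun i => h.1 _, fun i => h.2 i.castSucc⟩

theorem udLen_succ {α : Type*} [MetricSpace α] {m : ℕ} (f : Fin (m + 2) → α) :
    udLen (m + 1) f = udLen m (fun i => f i.castSucc)
      + dist (f (Fin.last m).castSucc) (f (Fin.last (m + 1))) := by
  unfold udLen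
  rw [Fin.sum_univ_castSucc]
  rfl

theorem udReach_prefix {α : Type*} [MetricSpace α] {P : Set α} (m : ℕ) :
    ∀ f : Fin (m + 1) → α, IsUDPath P m f → ∀ i, UDReach P (udLen m f) (f 0) (f i) := by
  induction m with
  | zero =>
    intro f hf i
    refine ⟨0, f, hf, rfl, ?_, le_rfl⟩
    congr 1
    exact (Fin.fin_one_eq_zero i).symm
  | succ m ih =>
    intro f hf i
    refine Fin.lastCases ?_ (fun i => ?_) i
    · exact ⟨m + 1, f, hf, rfl, rfl, le_rfl⟩
    · refine (ih _ (udPath_init hf) i).mono ?_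
      rw [udLen_succ]
      linarith [dist_nonneg (x := f (Fin.last m).castSucc) (y := f (Fin.last (m + 1)))]

theorem udReach_back {α : Type*} [MetricSpace α] {P : Set α} (p : α) (m : ℕ) :
    ∀ f : Fin (m + 1) → α, IsUDPath P m f → ∀ i L, UDReach P L p (f i) →
      UDReach P (L + udLen m f) p (f 0) := by
  induction m with
  | zero =>
    intro f hf i L h
    have : i = 0 := Fin.fin_one_eq_zero i
    subst this
    exact h.mono (by simp [udLen])
  | succ m ih =>
    intro f hf i
    refine Fin.lastCases ?_ (fun i => ?_) i
    · intro L h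
      have hd : dist (f (Fin.last (m + 1))) (f (Fin.last m).castSucc) ≤ 1 := by
        rw [dist_comm]; exact hf.2 (Fin.last m)
      have h2 := ih _ (udPath_init hf) (Fin.last m) _ (h.snoc (hf.1 _) hd)
      refine h2.mono ?_
      rw [udLen_succ, dist_comm]
      linarith
    · intro L h
      refine (ih _ (udPath_init hf) i L h).mono ?_
      rw [udLen_succ]
      linarith [dist_nonneg (x := f (Fin.last m).castSucc) (y := f (Fin.last (m + 1)))]

theorem dist_sq_two (x y : EuclideanSpace ℝ (Fin 2)) :
    dist x y ^ 2 = (x 0 - y 0) ^ 2 + (x 1 - y 1) ^ 2 := by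
  rw [EuclideanSpace.dist_eq, Real.sq_sqrt (by positivity)]
  simp [Fin.sum_univ_two, Real.dist_eq, sq_abs]

theorem quarter (s : ℝ) : s * (1 - s) ≤ 1 / 4 := by
  nlinarith [sq_nonneg (s - 1 / 2)]

/-- Two edges meeting a common cell have a pair of endpoints at distance at most one. -/
theorem close_endpoints (u v u' v' x x' : EuclideanSpace ℝ (Fin 2)) (a b : ℤ)
    (h : dist u v ≤ 1) (h' : dist u' v' ≤ 1)
    (hx : x ∈ segment ℝ u v) (hx' : x' ∈ segment ℝ u' v')
    (hc : x ∈ gridCell a b) (hc' : x' ∈ gridCell a b) :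
    dist u u' ≤ 1 ∨ dist u v' ≤ 1 ∨ dist v u' ≤ 1 ∨ dist v v' ≤ 1 := by
  by_contra hcon
  push Not at hcon
  obtain ⟨h1, h2, h3, h4⟩ := hcon
  have key : ∀ y z : EuclideanSpace ℝ (Fin 2), 1 < dist y z →
      1 < (y 0 - z 0) ^ 2 + (y 1 - z 1) ^ 2 := by
    intro y z hyz
    rw [← dist_sq_two]; nlinarith
  have key' : ∀ y z : EuclideanSpace ℝ (Fin 2), dist y z ≤ 1 →
      (y 0 - z 0) ^ 2 + (y 1 - z 1) ^ 2 ≤ 1 := by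
    intro y z hyz
    rw [← dist_sq_two]; nlinarith [dist_nonneg (x := y) (y := z)]
  have g1 := key _ _ h1
  have g2 := key _ _ h2
  have g3 := key _ _ h3
  have g4 := key _ _ h4
  have g := key' _ _ h
  have g' := key' _ _ h'
  obtain ⟨s, t, hs, ht, hst, rfl⟩ := hx
  obtain ⟨s', t', hs', ht', hst', rfl⟩ := hx'
  simp only [gridCell, mem_ofPred_eq, PiLp.add_apply, PiLp.smul_apply, smul_eq_mul] at hc hc'
  obtain ⟨c1, c2, c3, c4⟩ := hc
  obtain ⟨d1, d2, d3, d4⟩ := hc'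
  generalize u 0 = u0 at *
  generalize u 1 = u1 at *
  generalize v 0 = v0 at *
  generalize v 1 = v1 at *
  generalize u' 0 = w0 at *
  generalize u' 1 = w1 at *
  generalize v' 0 = z0 at *
  generalize v' 1 = z1 at *
  have b0 : ((s * u0 + t * v0) - (s' * w0 + t' * z0)) ^ 2 ≤ (1 / 8) ^ 2 := by
    apply sq_le_sq'  <;> linarith
  have b1 : ((s * u1 + t * v1) - (s' * w1 + t' * z1)) ^ 2 ≤ (1 / 8) ^ 2 := by
    apply sq_le_sq'  <;> linarith
  have ht1 : t = 1 - s := by linarith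
  have ht1' : t' = 1 - s' := by linarith
  have k : s * t * ((u0 - v0) ^ 2 + (u1 - v1) ^ 2) ≤ 1 / 4 := by
    have : s * t ≤ 1 / 4 := by rw [ht1]; exact quarter s
    have := mul_le_mul this g (by positivity) (by norm_num)
    linarith
  have k' : s' * t' * ((w0 - z0) ^ 2 + (w1 - z1) ^ 2) ≤ 1 / 4 := by
    have : s' * t' ≤ 1 / 4 := by rw [ht1']; exact quarter s'
    have := mul_le_mul this g' (by positivity) (by norm_num)
    linarith
  have m1 := mul_le_mul_of_nonneg_left g1.le (mul_nonneg hs hs')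
  have m2 := mul_le_mul_of_nonneg_left g2.le (mul_nonneg hs ht')
  have m3 := mul_le_mul_of_nonneg_left g3.le (mul_nonneg ht hs')
  have m4 := mul_le_mul_of_nonneg_left g4.le (mul_nonneg ht ht')
  clear g1 g2 g3 g4 g g' c1 c2 c3 c4 d1 d2 d3 d4
  subst ht1 ht1'
  linarith [m1, m2, m3, m4, k, k', b0, b1]

/-- **Shortcutting through a common grid cell.** If the polygonal curves traced by two
paths `π_p` (starting at `p`) and `π_q` (starting at `q`) in the unit-distance graph of
`P` both meet a common cell of the grid of sidelength `1/8`, then there is a path in the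
graph from `p` to `q` of length at most `len(π_p) + len(π_q) + 1`; in particular, if the
graph is connected, `d_G(p,q) ≤ len(π_p) + len(π_q) + 1`. -/
theorem common_cell_shortcut
    (P : Set (EuclideanSpace ℝ (Fin 2))) (hPfin : P.Finite)
    (p q : EuclideanSpace ℝ (Fin 2)) (hp : p ∈ P) (hq : q ∈ P)
    (mp : ℕ) (fp : Fin (mp + 1) → EuclideanSpace ℝ (Fin 2))
    (hfp : IsUDPath P mp fp) (hfp0 : fp 0 = p)
    (mq : ℕ) (fq : Fin (mq + 1) → EuclideanSpace ℝ (Fin 2))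
    (hfq : IsUDPath P mq fq) (hfq0 : fq 0 = q)
    (a b : ℤ)
    (hcellp : (gridCell a b ∩ udTrace mp fp).Nonempty)
    (hcellq : (gridCell a b ∩ udTrace mq fq).Nonempty) :
    (∃ m, ∃ f : Fin (m + 1) → EuclideanSpace ℝ (Fin 2),
      IsUDPath P m f ∧ f 0 = p ∧ f (Fin.last m) = q ∧
      udLen m f ≤ udLen mp fp + udLen mq fq + 1) ∧
    (UDConnected P → dG P p q ≤ udLen mp fp + udLen mq fq + 1) := by
  have main : UDReach P (udLen mp fp + udLen mq fq + 1) p q := by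
    obtain ⟨x, hxc, hx⟩ := hcellp
    obtain ⟨y, hyc, hy⟩ := hcellq
    obtain ⟨i, hi⟩ := mem_iUnion.1 hx
    obtain ⟨j, hj⟩ := mem_iUnion.1 hy
    have join : ∀ i j, dist (fp i) (fq j) ≤ 1 →
        UDReach P (udLen mp fp + udLen mq fq + 1) p q := by
      intro i j hd
      have r := (udReach_prefix mp fp hfp i).snoc (hfq.1 j) hd
      rw [hfp0] at r
      have r2 := udReach_back p mq fq hfq j _ r
      rw [hfq0] at r2
      exact r2.mono (by linarith)
    rcases close_endpoints _ _ _ _ x y a b (hfp.2 i) (hfq.2 j) hi hj hxc hyc with h | h | h | h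
    · exact join _ _ h
    · exact join _ _ h
    · exact join _ _ h
    · exact join _ _ h
  refine ⟨main, fun _ => ?_⟩
  obtain ⟨m, f, h1, h2, h3, h4⟩ := main
  refine le_trans (csInf_le ⟨0, ?_⟩ ⟨m, f, h1, h2, h3, rfl⟩) h4
  rintro t ⟨m, f, -, -, -, rfl⟩
  exact Finset.sum_nonneg fun i _ => dist_nonneg
end

section
/- There is a universal constant c > 0 such that the following holds. Let P ⊆ ℝ² be a finite set whose weighted unit-distance graph G is connected, let R ≥ r > 8, let Q be an r-packing of P with respect to the metric d_G, and let s ∈ Q. Then |{ y ∈ Q : 0 < d_G(s, y) ≤ R }| ≤ c·R²/r. -/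
open Metric Set

/-- `Q` is an `r`-packing of `P` with respect to the shortest-path metric `d_G`:
every point of `P` is at `d_G`-distance less than `r` from `Q`, and distinct points
of `Q` are at `d_G`-distance at least `r`. -/
def IsPackingG {α : Type*} [MetricSpace α] (P Q : Set α) (r : ℝ) : Prop :=
  Q ⊆ P ∧ (∀ p ∈ P, ∃ q ∈ Q, dG P p q < r) ∧
    ∀ q ∈ Q, ∀ q' ∈ Q, q ≠ q' → r ≤ dG P q q'


/-- Inductive version of the existence of a path of given length. -/
inductive UDWalk {α : Type*} [MetricSpace α] (P : Set α) (x : α) : α → ℝ → Prop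
  | refl : x ∈ P → UDWalk P x x 0
  | step {y z : α} {t : ℝ} : UDWalk P x y t → z ∈ P → dist y z ≤ 1 →
      UDWalk P x z (t + dist y z)

namespace UDWalk

variable {α : Type*} [MetricSpace α] {P : Set α}

lemma of_path : ∀ (m : ℕ) (f : Fin (m + 1) → α), IsUDPath P m f →
    UDWalk P (f 0) (f (Fin.last m)) (udLen m f) := by
  intro m
  induction m with
  | zero =>
    intro f hf
    have : udLen 0 f = 0 := by simp [udLen]
    rw [this]
    exact UDWalk.refl (hf.1 0)
  | succ m ih =>
    intro f hf
    have h1 : IsUDPath P m (fun i => f i.castSucc) :=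
      ⟨fun i => hf.1 _, fun i => hf.2 i.castSucc⟩
    have h2 := ih _ h1
    have h3 : udLen (m+1) f = udLen m (fun i => f i.castSucc) +
        dist (f (Fin.last m).castSucc) (f (Fin.last (m+1))) := by
      unfold udLen
      rw [Fin.sum_univ_castSucc]
      rfl
    rw [h3]
    exact UDWalk.step h2 (hf.1 _) (hf.2 (Fin.last m))

lemma to_path {x y : α} {t : ℝ} (h : UDWalk P x y t) : ∃ m, ∃ f : Fin (m + 1) → α,
    IsUDPath P m f ∧ f 0 = x ∧ f (Fin.last m) = y ∧ udLen m f = t := by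
  induction h with
  | refl hx => exact ⟨0, fun _ => x, ⟨fun _ => hx, fun i => i.elim0⟩, rfl, rfl, by simp [udLen]⟩
  | @step y z t _ hz hd ih =>
    obtain ⟨m, f, hf, h0, hl, ht⟩ := ih
    refine ⟨m+1, Fin.snoc (α := fun _ => α) f z, ⟨?_, ?_⟩, ?_, ?_, ?_⟩
    · intro i
      refine Fin.lastCases ?_ (fun j => ?_) i
      · simpa using hz
      · simpa using hf.1 j
    · intro i
      refine Fin.lastCases ?_ (fun j => ?_) i
      · simpa [hl] using hd
      · rw [Fin.succ_castSucc, Fin.snoc_castSucc, Fin.snoc_castSucc]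
        exact hf.2 j
    · rw [← Fin.castSucc_zero, Fin.snoc_castSucc, h0]
    · simp
    · unfold udLen
      rw [Fin.sum_univ_castSucc]
      congr 1
      · rw [← ht]
        unfold udLen
        refine Finset.sum_congr rfl fun j _ => ?_
        rw [Fin.succ_castSucc, Fin.snoc_castSucc, Fin.snoc_castSucc]
      · simp [hl]

lemma mem_left {x y : α} {t : ℝ} (h : UDWalk P x y t) : x ∈ P := by
  induction h with
  | refl hx => exact hx
  | step _ _ _ ih => exact ih

lemma mem_right {x y : α} {t : ℝ} (h : UDWalk P x y t) : y ∈ P := by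
  cases h with
  | refl hx => exact hx
  | step _ hz _ => exact hz

lemma trans {x y z : α} {t u : ℝ} (h : UDWalk P x y t) (h' : UDWalk P y z u) :
    UDWalk P x z (t + u) := by
  induction h' with
  | refl _ => simpa using h
  | step _ hz hd ih => rw [← add_assoc]; exact UDWalk.step ih hz hd

lemma symm {x y : α} {t : ℝ} (h : UDWalk P x y t) : UDWalk P y x t := by
  induction h with
  | refl hx => exact UDWalk.refl hx
  | @step y z t h1 hz hd ih =>
    have := UDWalk.step (UDWalk.refl hz) h1.mem_right (by rwa [dist_comm])
    have := this.trans ih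
    rw [dist_comm z y, zero_add, add_comm] at this
    exact this

lemma dist_le {x y : α} {t : ℝ} (h : UDWalk P x y t) : dist x y ≤ t := by
  induction h with
  | refl hx => simp
  | @step y z t h1 hz hd ih => linarith [dist_triangle x y z]

end UDWalk

section dGfacts

variable {α : Type*} [MetricSpace α] {P : Set α}

lemma dG_eq_sInf (x y : α) : dG P x y = sInf {t | UDWalk P x y t} := by
  unfold dG
  congr 1
  ext t
  constructor
  · rintro ⟨m, f, hf, rfl, rfl, rfl⟩
    exact UDWalk.of_path m f hf
  · exact fun h => h.to_path

lemma dG_le {x y : α} {t : ℝ} (h : UDWalk P x y t) : dG P x y ≤ t := by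
  rw [dG_eq_sInf]
  exact csInf_le ⟨dist x y, fun _ h => h.dist_le⟩ h

lemma exists_walk (hP : UDConnected P) {x y : α} (hx : x ∈ P) (hy : y ∈ P) :
    ∃ t, UDWalk P x y t := by
  obtain ⟨m, f, hf, rfl, rfl⟩ := hP x hx y hy
  exact ⟨_, UDWalk.of_path m f hf⟩

lemma dist_le_dG (hP : UDConnected P) {x y : α} (hx : x ∈ P) (hy : y ∈ P) :
    dist x y ≤ dG P x y := by
  rw [dG_eq_sInf]
  exact le_csInf (exists_walk hP hx hy) fun _ h => h.dist_le

lemma exists_walk_lt (hP : UDConnected P) {x y : α} (hx : x ∈ P) (hy : y ∈ P) {e : ℝ}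
    (he : 0 < e) : ∃ t, UDWalk P x y t ∧ t < dG P x y + e := by
  have : sInf {t | UDWalk P x y t} < dG P x y + e := by rw [← dG_eq_sInf]; linarith
  obtain ⟨t, ht, h⟩ := exists_lt_of_csInf_lt (exists_walk hP hx hy) this
  exact ⟨t, ht, h⟩

lemma dG_comm (x y : α) : dG P x y = dG P y x := by
  rw [dG_eq_sInf, dG_eq_sInf]
  congr 1
  ext t
  exact ⟨UDWalk.symm, UDWalk.symm⟩

lemma dG_triangle (hP : UDConnected P) {x y z : α} (hx : x ∈ P) (hy : y ∈ P) (hz : z ∈ P) :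
    dG P x z ≤ dG P x y + dG P y z := by
  refine le_of_forall_pos_le_add fun e he => ?_
  obtain ⟨t, ht, h⟩ := exists_walk_lt hP hx hy (half_pos he)
  obtain ⟨u, hu, h'⟩ := exists_walk_lt hP hy hz (half_pos he)
  linarith [dG_le (ht.trans hu)]

lemma dG_le_dist {x y : α} (hx : x ∈ P) (hy : y ∈ P) (h : dist x y ≤ 1) :
    dG P x y ≤ dist x y := by
  have := dG_le (UDWalk.step (UDWalk.refl hx) hy h)
  linarith

lemma dG_self_le {x : α} (hx : x ∈ P) : dG P x x ≤ 0 := dG_le (UDWalk.refl hx)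

lemma exists_mid (hP : UDConnected P) {x y : α} {t a : ℝ} (h : UDWalk P x y t)
    (ha : 0 ≤ a) (hay : a ≤ dG P x y) : ∃ z ∈ P, a ≤ dG P x z ∧ dG P x z ≤ a + 1 := by
  induction h with
  | refl hx => exact ⟨x, hx, hay, by linarith [dG_self_le hx]⟩
  | @step y z t h1 hz hd ih =>
    by_cases hc : a ≤ dG P x y
    · exact ih hc
    · refine ⟨z, hz, hay, ?_⟩
      linarith [dG_triangle hP h1.mem_left h1.mem_right hz, dG_le_dist h1.mem_right hz hd]

end dGfacts

lemma abs_coord_le (x y : EuclideanSpace ℝ (Fin 2)) (i : Fin 2) : |x i - y i| ≤ dist x y := by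
  rw [dist_eq_norm]
  exact PiLp.norm_apply_le (x - y) i

lemma dist_le_one_of_cell (s x y : EuclideanSpace ℝ (Fin 2))
    (h : ∀ i, ⌊2 * (x i - s i)⌋ = ⌊2 * (y i - s i)⌋) : dist x y ≤ 1 := by
  have hb : ∀ i, (x i - y i) ^ 2 ≤ 1 / 4 := by
    intro i
    have h1 := Int.abs_sub_lt_one_of_floor_eq_floor (h i)
    rw [abs_lt] at h1
    nlinarith
  rw [EuclideanSpace.dist_eq, Real.sqrt_le_iff]
  refine ⟨by norm_num, ?_⟩
  simp only [Fin.sum_univ_two, Real.dist_eq, sq_abs]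
  linarith [hb 0, hb 1]

theorem packing_points_nearby :
    ∃ c : ℝ, 0 < c ∧
      ∀ (P : Set (EuclideanSpace ℝ (Fin 2))), P.Finite → UDConnected P →
      ∀ r R : ℝ, 8 < r → r ≤ R →
      ∀ Q : Set (EuclideanSpace ℝ (Fin 2)), IsPackingG P Q r →
      ∀ s ∈ Q,
        (({y ∈ Q | 0 < dG P s y ∧ dG P s y ≤ R}).ncard : ℝ) ≤ c * R ^ 2 / r := by
  refine ⟨1296, by norm_num, ?_⟩
  intro P hPf hP r R hr hR Q hQ s hs
  obtain ⟨hQP, -, hsep⟩ := hQ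
  set Y := {y ∈ Q | 0 < dG P s y ∧ dG P s y ≤ R} with hY
  have hYf : Y.Finite := hPf.subset fun y hy => hQP hy.1
  have hsP := hQP hs
  set K := ⌊r / 8⌋₊ with hK
  have hK1 : (K : ℝ) ≤ r / 8 := Nat.floor_le (by linarith)
  have hK2 : r / 16 ≤ K := by
    have h1 : r / 8 < K + 1 := Nat.lt_floor_add_one _
    have h2 : 1 ≤ K := Nat.le_floor (by norm_num; linarith)
    have h3 : (1 : ℝ) ≤ K := by exact_mod_cast h2
    linarith
  have hz : ∀ y : EuclideanSpace ℝ (Fin 2), ∀ k : ℕ, ∃ z, y ∈ Y → k < K →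
      z ∈ P ∧ 3 * (k : ℝ) ≤ dG P y z ∧ dG P y z ≤ 3 * k + 1 := by
    intro y k
    by_cases hc : y ∈ Y ∧ k < K
    · obtain ⟨hy, hk⟩ := hc
      have hk' : (k : ℝ) + 1 ≤ K := by exact_mod_cast hk
      have hne : y ≠ s := by
        rintro rfl
        linarith [hy.2.1, dG_self_le hsP]
      have hd := hsep y hy.1 s hs hne
      obtain ⟨t, ht⟩ := exists_walk hP (hQP hy.1) hsP
      obtain ⟨z, h1, h2, h3⟩ := exists_mid hP ht (a := 3 * k) (by positivity) (by linarith)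
      exact ⟨z, fun _ _ => ⟨h1, h2, h3⟩⟩
    · exact ⟨s, fun h1 h2 => absurd ⟨h1, h2⟩ hc⟩
  choose z hz using hz
  set N : ℤ := ⌈4 * R⌉ with hN
  let F : EuclideanSpace ℝ (Fin 2) × ℕ → ℤ × ℤ := fun p =>
    (⌊2 * (z p.1 p.2 0 - s 0)⌋, ⌊2 * (z p.1 p.2 1 - s 1)⌋)
  have hcard : (hYf.toFinset ×ˢ Finset.range K).card ≤
      (Finset.Icc (-N) N ×ˢ Finset.Icc (-N) N).card := by
    refine Finset.card_le_card_of_injOn F ?_ ?_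
    · rintro ⟨y, k⟩ hp
      simp only [Finset.coe_product, Set.mem_prod, Finset.mem_coe, Finite.mem_toFinset,
        Finset.mem_range] at hp
      obtain ⟨hy, hk⟩ := hp
      obtain ⟨h1, h2, h3⟩ := hz y k hy hk
      have hk' : (k : ℝ) + 1 ≤ K := by exact_mod_cast hk
      have hd : dist (z y k) s ≤ 2 * R := by
        rw [dist_comm]
        linarith [dist_le_dG hP hsP h1, dG_triangle hP hsP (hQP hy.1) h1, hy.2.2]
      have hb : ∀ i, ⌊2 * (z y k i - s i)⌋ ∈ Finset.Icc (-N) N := by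
        intro i
        have h5 := (abs_coord_le (z y k) s i).trans hd
        rw [abs_le] at h5
        have h6 : 4 * R ≤ N := Int.le_ceil _
        rw [Finset.mem_Icc]
        constructor
        · rw [Int.le_floor]
          push_cast
          linarith
        · have : (⌊2 * (z y k i - s i)⌋ : ℝ) ≤ N := (Int.floor_le _).trans (by linarith)
          exact_mod_cast this
      simp only [Finset.coe_product, Set.mem_prod, Finset.mem_coe]
      exact ⟨hb 0, hb 1⟩
    · rintro ⟨y, k⟩ hp ⟨y', k'⟩ hp' hF
      simp only [Finset.coe_product, Set.mem_prod, Finset.mem_coe, Finite.mem_toFinset,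
        Finset.mem_range] at hp hp'
      obtain ⟨hy, hk⟩ := hp
      obtain ⟨hy', hk'⟩ := hp'
      obtain ⟨h1, h2, h3⟩ := hz y k hy hk
      obtain ⟨h1', h2', h3'⟩ := hz y' k' hy' hk'
      have hkr : (k : ℝ) + 1 ≤ K := by exact_mod_cast hk
      have hkr' : (k' : ℝ) + 1 ≤ K := by exact_mod_cast hk'
      simp only [F, Prod.mk.injEq] at hF
      have hd : dist (z y k) (z y' k') ≤ 1 := by
        refine dist_le_one_of_cell s _ _ fun i => ?_
        fin_cases i
        · exact hF.1
        · exact hF.2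
      have hdG := (dG_le_dist h1 h1' hd).trans hd
      have hyy : y = y' := by
        by_contra hne
        have h4 := hsep y hy.1 y' hy'.1 hne
        have h5 := dG_triangle hP (hQP hy.1) h1 (hQP hy'.1)
        have h6 := dG_triangle hP h1 h1' (hQP hy'.1)
        rw [dG_comm (z y' k') y'] at h6
        linarith
      subst hyy
      have h5 := dG_triangle hP (hQP hy.1) h1 h1'
      have h6 := dG_triangle hP (hQP hy.1) h1' h1
      rw [dG_comm (z y k') (z y k)] at h6
      have h7 : (k : ℝ) < k' + 1 := by linarith
      have h8 : (k' : ℝ) < k + 1 := by linarith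
      have h7' : k < k' + 1 := by exact_mod_cast h7
      have h8' : k' < k + 1 := by exact_mod_cast h8
      have : k = k' := by omega
      rw [this]
  rw [Finset.card_product, Finset.card_product, Finset.card_range, Int.card_Icc,
    ← Set.ncard_eq_toFinset_card Y hYf] at hcard
  have hN0 : (4 * R : ℝ) ≤ N := Int.le_ceil _
  have hN1 : (N : ℝ) < 4 * R + 1 := Int.ceil_lt_add_one _
  have hNpos : 0 ≤ N := by
    have : (0 : ℝ) ≤ N := by linarith
    exact_mod_cast this
  have hM : (((N + 1 - -N).toNat : ℕ) : ℝ) = 2 * N + 1 := by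
    have : (((N + 1 - -N).toNat : ℕ) : ℤ) = 2 * N + 1 := by omega
    exact_mod_cast this
  have hc : (Y.ncard : ℝ) * K ≤ (2 * N + 1) * (2 * N + 1) := by
    rw [← hM]
    exact_mod_cast hcard
  have hfin : (Y.ncard : ℝ) * (r / 16) ≤ 81 * R ^ 2 := by
    calc (Y.ncard : ℝ) * (r / 16) ≤ Y.ncard * K := by gcongr
      _ ≤ _ := hc
      _ ≤ (9 * R) * (9 * R) := by
        apply mul_self_le_mul_self <;> linarith
      _ = _ := by ring
  rw [le_div_iff₀ (by linarith)]
  linarith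
end

section
/- There is a universal constant c > 0 such that the following holds. For every ε ∈ (0,1) and every finite set P ⊆ ℝ² of n ≥ 2 points whose weighted unit-distance graph G is connected, there exists a (1/ε)-WSPD of P with respect to the shortest-path metric d_G whose size is at most c·ε⁻²·n·log₂ n. -/
open Metric Set

/-- Diameter of a set with respect to the shortest-path metric `d_G`. -/
noncomputable def dGDiam {α : Type*} [MetricSpace α] (P : Set α) (A : Set α) : ℝ :=
  sSup {t | ∃ a ∈ A, ∃ b ∈ A, t = dG P a b}

/-- Distance between two sets with respect to the shortest-path metric `d_G`. -/
noncomputable def dGSetDist {α : Type*} [MetricSpace α] (P : Set α) (A B : Set α) : ℝ :=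
  sInf {t | ∃ a ∈ A, ∃ b ∈ B, t = dG P a b}

/-- The pair `{A, B}` is `s`-separated with respect to `d_G`. -/
def WellSepG {α : Type*} [MetricSpace α] (P : Set α) (s : ℝ) (A B : Set α) : Prop :=
  max (dGDiam P A) (dGDiam P B) ≤ (1 / s) * dGSetDist P A B

/-- `W` is an `s`-WSPD of `P` with respect to the shortest-path metric `d_G`. -/
def IsWSPDG {α : Type*} [MetricSpace α] (P : Set α) (s : ℝ)
    (W : Finset (Set α × Set α)) : Prop :=
  (∀ pr ∈ W, pr.1 ⊆ P ∧ pr.2 ⊆ P ∧ pr.1.Nonempty ∧ pr.2.Nonempty ∧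
      Disjoint pr.1 pr.2 ∧ WellSepG P s pr.1 pr.2) ∧
  ∀ x ∈ P, ∀ y ∈ P, x ≠ y →
    ∃ pr ∈ W, (x ∈ pr.1 ∧ y ∈ pr.2) ∨ (x ∈ pr.2 ∧ y ∈ pr.1)

namespace WSPDAux

/-- Inductive reformulation of paths, recording the length. -/
inductive UDR {α : Type*} [MetricSpace α] (P : Set α) (x : α) : α → ℝ → Prop
  | refl : x ∈ P → UDR P x x 0
  | tail {y z : α} {t : ℝ} : UDR P x y t → z ∈ P → dist y z ≤ 1 → UDR P x z (t + dist y z)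

section Paths

variable {α : Type*} [MetricSpace α] {P : Set α}

lemma UDR.mem_right {x y : α} {t : ℝ} (h : UDR P x y t) : y ∈ P := by
  cases h <;> assumption

lemma UDR.mem_left {x y : α} {t : ℝ} (h : UDR P x y t) : x ∈ P := by
  induction h <;> assumption

lemma UDR.trans {x y z : α} {t u : ℝ} (h : UDR P x y t) (h' : UDR P y z u) :
    UDR P x z (t + u) := by
  induction h' with
  | refl => simpa using h
  | tail _ hz hd ih => rw [← add_assoc]; exact ih.tail hz hd

lemma UDR.symm {x y : α} {t : ℝ} (h : UDR P x y t) : UDR P y x t := by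
  induction h with
  | refl hx => exact UDR.refl hx
  | @tail y z t h hz hd ih =>
    have h1 : UDR P z y (0 + dist z y) := (UDR.refl hz).tail h.mem_right (by rwa [dist_comm])
    have := h1.trans ih
    rwa [zero_add, add_comm, dist_comm] at this

lemma UDR.dist_le {x y : α} {t : ℝ} (h : UDR P x y t) : dist x y ≤ t := by
  induction h with
  | refl hx => simp
  | @tail y z t h hz hd ih => linarith [dist_triangle x y z]

lemma udr_of_path (m : ℕ) (f : Fin (m + 1) → α) (hf : IsUDPath P m f) :
    UDR P (f 0) (f (Fin.last m)) (udLen m f) := by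
  induction m with
  | zero =>
    have := UDR.refl (hf.1 0)
    simpa [udLen] using this
  | succ m ih =>
    have h1 := ih (fun i => f i.castSucc) ⟨fun i => hf.1 _, fun i => hf.2 i.castSucc⟩
    have h2 := h1.tail (hf.1 (Fin.last (m+1))) (hf.2 (Fin.last m))
    unfold udLen at *
    rw [Fin.sum_univ_castSucc]
    exact h2

lemma path_of_udr {x y : α} {t : ℝ} (h : UDR P x y t) :
    ∃ m, ∃ f : Fin (m + 1) → α, IsUDPath P m f ∧ f 0 = x ∧ f (Fin.last m) = y ∧ udLen m f = t := by
  induction h with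
  | refl hx => exact ⟨0, fun _ => x, ⟨fun _ => hx, fun i => i.elim0⟩, rfl, rfl, by simp [udLen]⟩
  | @tail y z t h hz hd ih =>
    obtain ⟨m, f, hf, h0, hl, hlen⟩ := ih
    have key : ∀ i : Fin m, (Fin.snoc f z : Fin (m + 2) → α) i.castSucc.succ = f i.succ := by
      intro i
      rw [Fin.succ_castSucc]
      exact Fin.snoc_castSucc (α := fun _ => α) z f i.succ
    have kc : ∀ i : Fin (m+1), (Fin.snoc f z : Fin (m + 2) → α) i.castSucc = f i :=
      fun i => Fin.snoc_castSucc (α := fun _ => α) z f i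
    have kl : (Fin.snoc f z : Fin (m + 2) → α) (Fin.last (m+1)) = z :=
      Fin.snoc_last (α := fun _ => α) z f
    refine ⟨m + 1, Fin.snoc f z, ⟨?_, ?_⟩, ?_, kl, ?_⟩
    · intro i
      refine Fin.lastCases ?_ (fun i => ?_) i
      · rw [kl]; exact hz
      · rw [kc]; exact hf.1 i
    · intro i
      refine Fin.lastCases ?_ (fun i => ?_) i
      · rw [kc, Fin.succ_last, kl, hl]; exact hd
      · rw [kc, key]; exact hf.2 i
    · have := kc 0
      rw [Fin.castSucc_zero] at this
      rw [this, h0]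
    · unfold udLen at *
      rw [Fin.sum_univ_castSucc, Fin.succ_last, kl, kc, hl, ← hlen]
      congr 1
      refine Finset.sum_congr rfl (fun i _ => ?_)
      rw [kc, key]

lemma dG_eq (x y : α) : dG P x y = sInf {t | UDR P x y t} := by
  unfold dG
  congr 1
  ext t
  constructor
  · rintro ⟨m, f, hf, rfl, rfl, rfl⟩
    exact udr_of_path m f hf
  · exact path_of_udr

lemma exists_udr (hP : UDConnected P) {x y : α} (hx : x ∈ P) (hy : y ∈ P) :
    ∃ t, UDR P x y t := by
  obtain ⟨m, f, hf, rfl, rfl⟩ := hP x hx y hy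
  exact ⟨_, udr_of_path m f hf⟩

lemma bdd (x y : α) : BddBelow {t | UDR P x y t} :=
  ⟨0, fun _ ht => dist_nonneg.trans (UDR.dist_le ht)⟩

lemma dG_le {x y : α} {t : ℝ} (h : UDR P x y t) : dG P x y ≤ t := by
  rw [dG_eq]; exact csInf_le (bdd x y) h

lemma dG_comm (x y : α) : dG P x y = dG P y x := by
  rw [dG_eq, dG_eq]
  congr 1
  ext t
  exact ⟨UDR.symm, UDR.symm⟩

lemma dist_le_dG (hP : UDConnected P) {x y : α} (hx : x ∈ P) (hy : y ∈ P) :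
    dist x y ≤ dG P x y := by
  rw [dG_eq]
  exact le_csInf (exists_udr hP hx hy) (fun t ht => UDR.dist_le ht)

lemma dG_le_dist {x y : α} (hx : x ∈ P) (hy : y ∈ P) (h : dist x y ≤ 1) :
    dG P x y ≤ dist x y := by
  have := dG_le ((UDR.refl hx).tail hy h)
  linarith

lemma dG_triangle (hP : UDConnected P) {x y z : α} (hx : x ∈ P) (hy : y ∈ P) (hz : z ∈ P) :
    dG P x z ≤ dG P x y + dG P y z := by
  have h1 : ∀ t, UDR P x y t → ∀ u, UDR P y z u → dG P x z ≤ t + u :=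
    fun t ht u hu => dG_le (ht.trans hu)
  have h2 : ∀ t, UDR P x y t → dG P x z - t ≤ dG P y z := by
    intro t ht
    rw [dG_eq y z]
    exact le_csInf (exists_udr hP hy hz) (fun u hu => by linarith [h1 t ht u hu])
  have h3 : dG P x z - dG P y z ≤ dG P x y := by
    rw [dG_eq x y]
    exact le_csInf (exists_udr hP hx hy) (fun u hu => by linarith [h2 u hu])
  linarith

lemma dG_self {x : α} (hx : x ∈ P) (hP : UDConnected P) : dG P x x = 0 := by
  apply le_antisymm
  · exact dG_le (UDR.refl hx)
  · simpa using dist_le_dG hP hx hx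

/-- Discrete intermediate value theorem. -/
lemma dG_ivt (hP : UDConnected P) {x y : α} (hx : x ∈ P) (hy : y ∈ P) {s : ℝ} (hs : 0 ≤ s)
    (hsd : s ≤ dG P x y) : ∃ z ∈ P, s ≤ dG P x z ∧ dG P x z ≤ s + 1 := by
  obtain ⟨t, ht⟩ := exists_udr hP hx hy
  clear hy
  induction ht with
  | refl h => exact ⟨x, hx, hsd, by rw [dG_self hx hP]; linarith⟩
  | @tail y z t h hz hd ih =>
    by_cases hc : s ≤ dG P x y
    · exact ih hc
    · refine ⟨z, hz, hsd, ?_⟩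
      have := dG_triangle hP hx h.mem_right hz
      have := dG_le_dist h.mem_right hz hd
      push Not at hc
      linarith

end Paths

section Nets

variable {α : Type*} [DecidableEq α]

lemma extend_net (P : Finset α) (d : α → α → ℝ) (r : ℝ) (hr : 0 ≤ r)
    (hself : ∀ x ∈ P, d x x = 0) (hcomm : ∀ x y, d x y = d y x)
    (S : Finset α) (hSP : S ⊆ P) (hS : ∀ p ∈ S, ∀ q ∈ S, p ≠ q → r < d p q) :
    ∃ S' : Finset α, S ⊆ S' ∧ S' ⊆ P ∧ (∀ p ∈ S', ∀ q ∈ S', p ≠ q → r < d p q) ∧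
      ∀ x ∈ P, ∃ p ∈ S', d x p ≤ r := by
  classical
  let F := P.powerset.filter (fun S' => S ⊆ S' ∧ ∀ p ∈ S', ∀ q ∈ S', p ≠ q → r < d p q)
  have hF : F.Nonempty := ⟨S, by simp only [F, Finset.mem_filter, Finset.mem_powerset]; exact ⟨hSP, subset_rfl, hS⟩⟩
  obtain ⟨M, hM, hmax⟩ := F.exists_max_image Finset.card hF
  simp only [F, Finset.mem_filter, Finset.mem_powerset] at hM hmax
  obtain ⟨hMP, hSM, hsep⟩ := hM
  refine ⟨M, hSM, hMP, hsep, ?_⟩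
  intro x hx
  by_contra! hc
  have hxM : x ∉ M := fun h => by
    have := hc x h
    rw [hself x hx] at this
    linarith
  have := hmax (insert x M) ⟨?_, ?_, ?_⟩
  · rw [Finset.card_insert_of_notMem hxM] at this
    omega
  · exact Finset.insert_subset hx hMP
  · exact hSM.trans (Finset.subset_insert _ _)
  · intro p hp q hq hpq
    rw [Finset.mem_insert] at hp hq
    rcases hp with rfl | hp <;> rcases hq with rfl | hq
    · exact absurd rfl hpq
    · exact hc q hq
    · rw [hcomm]; exact hc p hp
    · exact hsep p hp q hq hpq

lemma exists_nets (P : Finset α) (d : α → α → ℝ) (r : ℕ → ℝ) (hr : ∀ t, 0 ≤ r t)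
    (hanti : ∀ t, r (t+1) ≤ r t)
    (hself : ∀ x ∈ P, d x x = 0) (hcomm : ∀ x y, d x y = d y x) :
    ∃ N : ℕ → Finset α, (∀ t, N t ⊆ N (t+1)) ∧ (∀ t, N t ⊆ P) ∧
      (∀ t, ∀ p ∈ N t, ∀ q ∈ N t, p ≠ q → r t < d p q) ∧
      ∀ t, ∀ x ∈ P, ∃ p ∈ N t, d x p ≤ r t := by
  choose! g hg using fun (t : ℕ) (S : Finset α)
    (h : S ⊆ P ∧ ∀ p ∈ S, ∀ q ∈ S, p ≠ q → r t < d p q) =>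
    extend_net P d (r t) (hr t) hself hcomm S h.1 h.2
  let N : ℕ → Finset α := fun t => Nat.rec (g 0 ∅) (fun t S => g (t+1) S) t
  have h0 : N 0 = g 0 ∅ := rfl
  have hs : ∀ t, N (t+1) = g (t+1) (N t) := fun t => rfl
  have hg0 := hg 0 ∅ ⟨by simp, by simp⟩
  have hinv : ∀ t, N t ⊆ P ∧ (∀ p ∈ N t, ∀ q ∈ N t, p ≠ q → r t < d p q) ∧
      ∀ x ∈ P, ∃ p ∈ N t, d x p ≤ r t := by
    intro t
    induction t with
    | zero => rw [h0]; exact hg0.2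
    | succ t ih =>
      rw [hs]
      exact (hg (t+1) (N t) ⟨ih.1, fun p hp q hq h => (hanti t).trans_lt (ih.2.1 p hp q hq h)⟩).2
  refine ⟨N, fun t => ?_, fun t => (hinv t).1, fun t => (hinv t).2.1, fun t => (hinv t).2.2⟩
  rw [hs]
  exact (hg (t+1) (N t) ⟨(hinv t).1,
    fun p hp q hq h => (hanti t).trans_lt ((hinv t).2.1 p hp q hq h)⟩).1

lemma card_filter_prod_le {β : Type*} (A : Finset α) (B : Finset β) (R : α → β → Prop)
    [∀ a b, Decidable (R a b)] (M : ℝ)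
    (h : ∀ a ∈ A, (((B.filter (R a)).card : ℕ) : ℝ) ≤ M) :
    ((((A ×ˢ B).filter (fun z => R z.1 z.2)).card : ℕ) : ℝ) ≤ A.card * M := by
  rw [Finset.card_filter, Finset.sum_product]
  push_cast
  rw [← nsmul_eq_mul]
  apply Finset.sum_le_card_nsmul
  intro a ha
  refine le_trans (le_of_eq ?_) (h a ha)
  rw [Finset.card_filter]
  push_cast
  rfl

lemma sum_levels (P : Finset α) (N : ℕ → Finset α) (hmono : Monotone N) (hNP : ∀ t, N t ⊆ P)
    (K T : ℕ) :
    ∑ t ∈ Finset.range T, ((N t).filter (fun p => K ≤ t → p ∉ N (t - K))).card ≤ K * P.card := by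
  classical
  have h1 : ∀ t, ((N t).filter (fun p => K ≤ t → p ∉ N (t - K))).card
      = ∑ p ∈ P, if (p ∈ N t ∧ (K ≤ t → p ∉ N (t - K))) then 1 else 0 := by
    intro t
    rw [← Finset.card_filter]
    congr 1
    ext p
    simp only [Finset.mem_filter]
    exact ⟨fun h => ⟨hNP t h.1, h⟩, fun h => h.2⟩
  simp only [h1]
  rw [Finset.sum_comm, mul_comm, ← smul_eq_mul]
  apply Finset.sum_le_card_nsmul
  intro p _
  rw [← Finset.card_filter]
  by_cases hex : ∃ t, p ∈ N t
  · have hsub : (Finset.range T).filter (fun t => p ∈ N t ∧ (K ≤ t → p ∉ N (t - K)))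
        ⊆ Finset.Ico (Nat.find hex) (Nat.find hex + K) := by
      intro t ht
      simp only [Finset.mem_filter, Finset.mem_range, Finset.mem_Ico] at ht ⊢
      refine ⟨Nat.find_min' hex ht.2.1, ?_⟩
      by_contra! hc
      exact ht.2.2 (by omega) (hmono (by omega) (Nat.find_spec hex))
    have := Finset.card_le_card hsub
    simpa using this
  · push Not at hex
    simp [hex]

end Nets

section Packing

local notation "E2" => EuclideanSpace ℝ (Fin 2)

lemma packing (S : Finset E2) (c : E2) (δ ρ : ℝ) (hδ : 0 < δ) (hρ : δ ≤ ρ)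
    (hsep : ∀ p ∈ S, ∀ q ∈ S, p ≠ q → δ ≤ dist p q) (hb : ∀ p ∈ S, dist c p ≤ ρ) :
    (S.card : ℝ) ≤ 49 * (ρ / δ) ^ 2 := by
  set m : ℤ := ⌈2 * ρ / δ⌉ with hm
  have hρδ : 1 ≤ ρ / δ := by rwa [le_div_iff₀ hδ, one_mul]
  let φ : E2 → ℤ × ℤ := fun x => (⌊2 * (x 0 - c 0) / δ⌋, ⌊2 * (x 1 - c 1) / δ⌋)
  have hdist : ∀ x y : E2, dist x y ^ 2 = (x 0 - y 0) ^ 2 + (x 1 - y 1) ^ 2 := by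
    intro x y
    rw [EuclideanSpace.dist_eq, Real.sq_sqrt (by positivity)]
    simp [Real.dist_eq, sq_abs]
  have hcoord : ∀ u : ℝ, |u| ≤ ρ → ⌊2 * u / δ⌋ ∈ Finset.Icc (-m) m := by
    intro u hu
    rw [abs_le] at hu
    have h1 : 2 * u / δ ≤ 2 * ρ / δ := by gcongr; exact hu.2
    have h2 : -(2 * ρ / δ) ≤ 2 * u / δ := by
      rw [← neg_div]; gcongr; linarith [hu.1]
    have hle := Int.le_ceil (2 * ρ / δ)
    rw [Finset.mem_Icc]
    constructor
    · rw [Int.le_floor]; push_cast; linarith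
    · have : ((⌊2 * u / δ⌋ : ℤ) : ℝ) ≤ (m : ℝ) := (Int.floor_le _).trans (h1.trans hle)
      exact_mod_cast this
  have hcard : S.card ≤ (Finset.Icc (-m) m ×ˢ Finset.Icc (-m) m).card := by
    apply Finset.card_le_card_of_injOn φ
    · intro x hx
      have h := hb x hx
      have h0 := hdist c x
      have hd : dist c x ^ 2 ≤ ρ ^ 2 := by gcongr
      have hρ0 : 0 ≤ ρ := by linarith
      refine Finset.mem_coe.2 (Finset.mem_product.2 ⟨hcoord _ ?_, hcoord _ ?_⟩)
      · apply abs_le_of_sq_le_sq _ hρ0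
        nlinarith [sq_nonneg (c 1 - x 1)]
      · apply abs_le_of_sq_le_sq _ hρ0
        nlinarith [sq_nonneg (c 0 - x 0)]
    · intro x hx y hy hxy
      by_contra hne
      have h := hsep x hx y hy hne
      simp only [φ, Prod.mk.injEq] at hxy
      have key : ∀ u v w : ℝ, ⌊2 * (u - w) / δ⌋ = ⌊2 * (v - w) / δ⌋ → (u - v) ^ 2 ≤ (δ / 2) ^ 2 := by
        intro u v w huv
        have := Int.abs_sub_lt_one_of_floor_eq_floor huv
        have e : 2 * (u - w) / δ - 2 * (v - w) / δ = (u - v) / (δ / 2) := by field_simp; ring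
        rw [e, abs_div, div_lt_one (by positivity)] at this
        exact sq_le_sq.2 this.le
      have h0 := key _ _ _ hxy.1
      have h1 := key _ _ _ hxy.2
      have h2 := hdist x y
      have h3 : δ ^ 2 ≤ dist x y ^ 2 := by gcongr
      nlinarith [sq_pos_of_pos hδ]
  have hm0 : (0 : ℝ) ≤ m := by
    have := Int.le_ceil (2 * ρ / δ)
    have : 0 ≤ 2 * ρ / δ := by rw [mul_div_assoc]; positivity
    linarith
  have hm0' : 0 ≤ m := by exact_mod_cast hm0
  have hIcc : ((Finset.Icc (-m) m).card : ℝ) = 2 * m + 1 := by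
    rw [Int.card_Icc]
    have h : ((m + 1 - -m).toNat : ℤ) = 2 * m + 1 := by omega
    exact_mod_cast h
  have hmu : (m : ℝ) ≤ 2 * (ρ / δ) + 1 := by
    have := Int.ceil_lt_add_one (2 * ρ / δ)
    rw [← hm] at this
    rw [mul_div_assoc] at this
    exact this.le
  calc (S.card : ℝ) ≤ ((Finset.Icc (-m) m ×ˢ Finset.Icc (-m) m).card : ℝ) := by exact_mod_cast hcard
    _ = (2 * m + 1) ^ 2 := by rw [Finset.card_product]; push_cast; rw [hIcc]; ring
    _ ≤ (7 * (ρ / δ)) ^ 2 := by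
      apply pow_le_pow_left₀ (by linarith)
      linarith
    _ = _ := by ring


lemma large_level (P : Finset E2) (hP : UDConnected (P : Set E2)) (N : Finset E2) (hNP : N ⊆ P)
    (r D : ℝ) (hr : 12 ≤ r) (hrD : r ≤ D)
    (hsep : ∀ p ∈ N, ∀ q ∈ N, p ≠ q → r < dG (P : Set E2) p q)
    (F : Finset (E2 × E2))
    (hF : ∀ z ∈ F, z.1 ∈ N ∧ z.2 ∈ N ∧ z.1 ≠ z.2 ∧ dG (P : Set E2) z.1 z.2 ≤ 4 * D) :
    (F.card : ℝ) ≤ 705600 * P.card * (D / r) ^ 2 := by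
  classical
  set d := dG (P : Set E2) with hd
  have dtri : ∀ x ∈ P, ∀ y ∈ P, ∀ z ∈ P, d x z ≤ d x y + d y z :=
    fun x hx y hy z hz => dG_triangle hP hx hy hz
  have dcomm : ∀ x y, d x y = d y x := fun x y => dG_comm x y
  obtain ⟨Q, -, hQP, hQsep, hQcov⟩ := extend_net P d 1 zero_le_one
    (fun x hx => dG_self hx hP) dcomm ∅ (by simp) (by simp)
  set k : ℕ := ⌈r / 24⌉₊ with hk
  have hk1 : r / 24 ≤ k := Nat.le_ceil _
  have hk2 : (k : ℝ) < r / 24 + 1 := Nat.ceil_lt_add_one (by linarith)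
  have hz : ∀ p, (p ∈ N ∧ ∃ q ∈ N, p ≠ q) → ∀ i : ℕ, i < k →
      ∃ z ∈ Q, 4 * (i : ℝ) - 1 ≤ d p z ∧ d p z ≤ 4 * i + 2 := by
    rintro p ⟨hp, q, hq, hpq⟩ i hi
    have hi' : (i : ℝ) + 1 ≤ k := by exact_mod_cast hi
    have hsd : 4 * (i : ℝ) ≤ d p q := by linarith [hsep p hp q hq hpq]
    obtain ⟨x, hx, hx1, hx2⟩ := dG_ivt hP (hNP hp) (hNP hq) (by positivity) hsd
    obtain ⟨z, hz, hxz⟩ := hQcov x hx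
    refine ⟨z, hz, ?_, ?_⟩
    · have := dtri p (hNP hp) z (hQP hz) x hx
      rw [dcomm z x] at this
      linarith
    · have := dtri p (hNP hp) x hx z (hQP hz)
      linarith
  choose! z hzQ hzl hzu using hz
  have hzr : ∀ p, (p ∈ N ∧ ∃ q ∈ N, p ≠ q) → ∀ i : ℕ, i < k → d p (z p i) ≤ r / 3 := by
    intro p hp i hi
    have h := hzu p hp i hi
    have hi' : (i : ℝ) + 1 ≤ k := by exact_mod_cast hi
    linarith
  have hact : ∀ w ∈ F, (w.1 ∈ N ∧ ∃ q ∈ N, w.1 ≠ q) ∧ (w.2 ∈ N ∧ ∃ q ∈ N, w.2 ≠ q) := by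
    intro w hw
    obtain ⟨h1, h2, h3, -⟩ := hF w hw
    exact ⟨⟨h1, w.2, h2, h3⟩, ⟨h2, w.1, h1, h3.symm⟩⟩
  have hzinj : ∀ p, (p ∈ N ∧ ∃ q ∈ N, p ≠ q) → ∀ p', (p' ∈ N ∧ ∃ q ∈ N, p' ≠ q) →
      ∀ i < k, ∀ j < k, z p i = z p' j → p = p' ∧ i = j := by
    intro p hp p' hp' i hi j hj hij
    have hpp : p = p' := by
      by_contra hne
      have h1 := hsep p hp.1 p' hp'.1 hne
      have h2 := dtri p (hNP hp.1) (z p i) (hQP (hzQ p hp i hi)) p' (hNP hp'.1)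
      have h3 := hzr p hp i hi
      have h4 := hzr p' hp' j hj
      rw [← hij, dcomm] at h4
      linarith
    subst hpp
    refine ⟨rfl, ?_⟩
    have h1 := hzl p hp i hi
    have h2 := hzu p hp i hi
    have h3 := hzl p hp j hj
    have h4 := hzu p hp j hj
    rw [← hij] at h3 h4
    have h5 : (i : ℝ) < j + 1 := by linarith
    have h6 : (j : ℝ) < i + 1 := by linarith
    have h5' : i < j + 1 := by exact_mod_cast h5
    have h6' : j < i + 1 := by exact_mod_cast h6
    omega
  have hcard : (F ×ˢ (Finset.range k ×ˢ Finset.range k)).card ≤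
      ((Q ×ˢ Q).filter (fun w => d w.1 w.2 ≤ 5 * D)).card := by
    apply Finset.card_le_card_of_injOn
      (fun w : (E2 × E2) × (ℕ × ℕ) => (z w.1.1 w.2.1, z w.1.2 w.2.2))
    · rintro ⟨w, i, j⟩ hw
      simp only [Finset.coe_product, Set.mem_prod, Finset.mem_coe, Finset.mem_range] at hw
      obtain ⟨hw, hi, hj⟩ := hw
      obtain ⟨ha, hb⟩ := hact w hw
      have hqa := hzQ _ ha i hi
      have hqb := hzQ _ hb j hj
      simp only [Finset.coe_filter, Finset.mem_product, Set.mem_ofPred_eq]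
      refine ⟨⟨hqa, hqb⟩, ?_⟩
      have h1 := dtri _ (hQP hqa) _ (hNP ha.1) _ (hQP hqb)
      have h2 := dtri _ (hNP ha.1) _ (hNP hb.1) _ (hQP hqb)
      have h3 := hzr _ ha i hi
      have h4 := hzr _ hb j hj
      have h5 := (hF w hw).2.2.2
      rw [dcomm] at h3
      linarith
    · rintro ⟨⟨p, q⟩, i, j⟩ hw ⟨⟨p', q'⟩, i', j'⟩ hw' he
      simp only [Finset.coe_product, Set.mem_prod, Finset.mem_coe, Finset.mem_range] at hw hw'
      simp only [Prod.mk.injEq] at he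
      obtain ⟨hw, hi, hj⟩ := hw
      obtain ⟨hw', hi', hj'⟩ := hw'
      obtain ⟨ha, hb⟩ := hact _ hw
      obtain ⟨ha', hb'⟩ := hact _ hw'
      obtain ⟨rfl, rfl⟩ := hzinj _ ha _ ha' i hi i' hi' he.1
      obtain ⟨rfl, rfl⟩ := hzinj _ hb _ hb' j hj j' hj' he.2
      rfl
  have hQn : ((((Q ×ˢ Q).filter (fun w => d w.1 w.2 ≤ 5 * D)).card : ℕ) : ℝ)
      ≤ Q.card * (49 * (5 * D / 1) ^ 2) := by
    apply card_filter_prod_le Q Q (fun a b => d a b ≤ 5 * D)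
    intro a ha
    apply packing _ a 1 (5 * D) one_pos (by linarith)
    · intro p hp q hq hpq
      rw [Finset.mem_filter] at hp hq
      by_contra! hc
      have h1 := hQsep p hp.1 q hq.1 hpq
      have h2 : d p q ≤ dist p q := dG_le_dist (hQP hp.1) (hQP hq.1) hc.le
      linarith
    · intro p hp
      rw [Finset.mem_filter] at hp
      exact (dist_le_dG hP (hQP ha) (hQP hp.1)).trans hp.2
  have hQcard : (Q.card : ℝ) ≤ P.card := by exact_mod_cast Finset.card_le_card hQP
  have h1 : (F.card : ℝ) * (k * k) ≤ P.card * (49 * (5 * D / 1) ^ 2) := by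
    refine le_trans ?_ (hQn.trans (by gcongr))
    have : ((F ×ˢ (Finset.range k ×ˢ Finset.range k)).card : ℝ) = F.card * (k * k) := by
      simp [Finset.card_product]
    rw [← this]
    exact_mod_cast hcard
  have h2 : (F.card : ℝ) * (r / 24 * (r / 24)) ≤ P.card * (49 * (5 * D / 1) ^ 2) := by
    refine le_trans ?_ h1
    gcongr
  rw [div_pow, ← mul_div_assoc, le_div_iff₀ (by positivity)]
  nlinarith

lemma small_level (P : Finset E2) (hP : UDConnected (P : Set E2)) (N : Finset E2) (hNP : N ⊆ P)
    (r D : ℝ) (hr0 : 0 < r) (hr : r ≤ 12) (hrD : r ≤ D)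
    (hsep : ∀ p ∈ N, ∀ q ∈ N, p ≠ q → r < dG (P : Set E2) p q)
    (A : Finset E2) (hA : A ⊆ N)
    (F : Finset (E2 × E2))
    (hF : ∀ z ∈ F, z.1 ∈ N ∧ z.2 ∈ N ∧ (z.1 ∈ A ∨ z.2 ∈ A) ∧ dG (P : Set E2) z.1 z.2 ≤ 4 * D) :
    (F.card : ℝ) ≤ 225792 * A.card * (D / r) ^ 2 := by
  classical
  set d := dG (P : Set E2) with hd
  have dcomm : ∀ x y, d x y = d y x := fun x y => dG_comm x y
  have hn : ((((A ×ˢ N).filter (fun w => d w.1 w.2 ≤ 4 * D)).card : ℕ) : ℝ)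
      ≤ A.card * (49 * (4 * D / (r / 12)) ^ 2) := by
    apply card_filter_prod_le A N (fun a b => d a b ≤ 4 * D)
    intro a ha
    apply packing _ a (r / 12) (4 * D) (by positivity) (by linarith)
    · intro p hp q hq hpq
      rw [Finset.mem_filter] at hp hq
      by_contra! hc
      have h1 := hsep p hp.1 q hq.1 hpq
      have h2 : d p q ≤ dist p q := dG_le_dist (hNP hp.1) (hNP hq.1) (by linarith)
      linarith
    · intro p hp
      rw [Finset.mem_filter] at hp
      exact (dist_le_dG hP (hNP (hA ha)) (hNP hp.1)).trans hp.2
  set X := (A ×ˢ N).filter (fun w => d w.1 w.2 ≤ 4 * D) with hX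
  have hsub : F ⊆ X ∪ X.image Prod.swap := by
    rintro ⟨p, q⟩ hw
    obtain ⟨h1, h2, h3, h4⟩ := hF _ hw
    rw [Finset.mem_union]
    rcases h3 with h3 | h3
    · left
      rw [hX, Finset.mem_filter, Finset.mem_product]
      exact ⟨⟨h3, h2⟩, h4⟩
    · right
      rw [Finset.mem_image]
      refine ⟨(q, p), ?_, rfl⟩
      rw [hX, Finset.mem_filter, Finset.mem_product]
      exact ⟨⟨h3, h1⟩, by rw [dcomm]; exact h4⟩
  have hc : F.card ≤ X.card + X.card :=
    (Finset.card_le_card hsub).trans ((Finset.card_union_le X (X.image Prod.swap)).trans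
      (Nat.add_le_add_left Finset.card_image_le _))
  have hc' : (F.card : ℝ) ≤ X.card + X.card := by exact_mod_cast hc
  have e : (4 * D / (r / 12)) = 48 * (D / r) := by field_simp; ring
  rw [e] at hn
  nlinarith

lemma dG_lt (P : Finset E2) (hP : UDConnected (P : Set E2)) {x y : E2} (hx : x ∈ P) (hy : y ∈ P) :
    dG (P : Set E2) x y < 2 * P.card := by
  by_contra! hc
  have hz : ∀ i : ℕ, i < P.card + 1 → ∃ z ∈ P, 2 * (i : ℝ) ≤ dG (P : Set E2) x z ∧
      dG (P : Set E2) x z ≤ 2 * i + 1 := by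
    intro i hi
    have hi' : (i : ℝ) ≤ P.card := by exact_mod_cast Nat.lt_succ_iff.1 hi
    exact dG_ivt hP hx hy (by positivity) (by linarith)
  choose! z hzP hz1 hz2 using hz
  have := Finset.card_le_card_of_injOn (s := Finset.range (P.card + 1)) (t := P) z
    (fun i hi => hzP i (by simpa using hi)) (by
      intro i hi j hj hij
      have hi : i < P.card + 1 := by simpa using hi
      have hj : j < P.card + 1 := by simpa using hj
      have h1 := hz1 i hi
      have h2 := hz2 i hi
      have h3 := hz1 j hj
      have h4 := hz2 j hj
      rw [← hij] at h3 h4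
      have h5 : (i : ℝ) < j + 1 := by linarith
      have h6 : (j : ℝ) < i + 1 := by linarith
      have h5' : i < j + 1 := by exact_mod_cast h5
      have h6' : j < i + 1 := by exact_mod_cast h6
      omega)
  simp at this

lemma wellSep_of (P : Set E2) (ε : ℝ) (A B : Set E2) (hA : A.Nonempty) (hB : B.Nonempty)
    (m δ : ℝ) (hε : 0 < ε)
    (h1 : ∀ a ∈ A, ∀ b ∈ A, dG P a b ≤ m) (h2 : ∀ a ∈ B, ∀ b ∈ B, dG P a b ≤ m)
    (h3 : ∀ a ∈ A, ∀ b ∈ B, δ ≤ dG P a b) (h : m ≤ ε * δ) : WellSepG P (1 / ε) A B := by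
  unfold WellSepG dGDiam dGSetDist
  obtain ⟨a, ha⟩ := hA
  obtain ⟨b, hb⟩ := hB
  have hδ : δ ≤ sInf {t | ∃ a ∈ A, ∃ b ∈ B, t = dG P a b} := by
    refine le_csInf ⟨dG P a b, a, ha, b, hb, rfl⟩ ?_
    rintro t ⟨a, ha, b, hb, rfl⟩
    exact h3 a ha b hb
  rw [one_div_one_div]
  refine le_trans (max_le ?_ ?_) (h.trans (by gcongr))
  · refine csSup_le ⟨dG P a a, a, ha, a, ha, rfl⟩ ?_
    rintro t ⟨a, ha, b, hb, rfl⟩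
    exact h1 a ha b hb
  · refine csSup_le ⟨dG P b b, b, hb, b, hb, rfl⟩ ?_
    rintro t ⟨a, ha, b, hb, rfl⟩
    exact h2 a ha b hb

lemma trivial_case (P : Finset E2) (hP : UDConnected (P : Set E2)) (ε : ℝ) (hε : 0 < ε) :
    ∃ W : Finset (Set E2 × Set E2), IsWSPDG (P : Set E2) (1 / ε) W ∧ W.card ≤ P.card * P.card := by
  classical
  refine ⟨((P ×ˢ P).filter (fun z => z.1 ≠ z.2)).image (fun z => ({z.1}, {z.2})), ⟨?_, ?_⟩, ?_⟩
  · intro pr hpr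
    rw [Finset.mem_image] at hpr
    obtain ⟨⟨x, y⟩, hz, rfl⟩ := hpr
    rw [Finset.mem_filter, Finset.mem_product] at hz
    obtain ⟨⟨hx, hy⟩, hne⟩ := hz
    refine ⟨by simpa using hx, by simpa using hy, by simp, by simp, by simpa using hne, ?_⟩
    apply wellSep_of _ _ _ _ (by simp) (by simp) 0 0 hε
    · rintro a rfl b rfl; exact (dG_self hx hP).le
    · rintro a rfl b rfl; exact (dG_self hy hP).le
    · rintro a rfl b rfl; exact dist_nonneg.trans (dist_le_dG hP hx hy)
    · simp
  · intro x hx y hy hne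
    refine ⟨({x}, {y}), ?_, Or.inl ⟨rfl, rfl⟩⟩
    rw [Finset.mem_image]
    exact ⟨(x, y), by simpa using ⟨⟨hx, hy⟩, hne⟩, rfl⟩
  · refine Finset.card_image_le.trans ((Finset.card_filter_le _ _).trans ?_)
    rw [Finset.card_product]

lemma main_case (P : Finset E2) (hP : UDConnected (P : Set E2)) (ε : ℝ) (hε : 0 < ε) (hε1 : ε < 1)
    (L : ℕ) (hL : P.card ≤ 2 ^ L) (hεL : 1 ≤ ε * 2 ^ L) :
    ∃ W : Finset (Set E2 × Set E2), IsWSPDG (P : Set E2) (1 / ε) W ∧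
      (W.card : ℝ) ≤ L * (705600 * P.card * (8 / ε) ^ 2)
        + 225792 * (((L + 5 : ℕ) : ℝ) * P.card) * (8 / ε) ^ 2 := by
  classical
  set d := dG (P : Set E2) with hd
  have dtri : ∀ x ∈ P, ∀ y ∈ P, ∀ z ∈ P, d x z ≤ d x y + d y z :=
    fun x hx y hy z hz => dG_triangle hP hx hy hz
  have dcomm : ∀ x y, d x y = d y x := fun x y => dG_comm x y
  have dself : ∀ x ∈ P, d x x = 0 := fun x hx => dG_self hx hP
  let D : ℕ → ℝ := fun t => 2 ^ L / 2 ^ t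
  let r : ℕ → ℝ := fun t => ε / 8 * D t
  have hD : ∀ t, 0 < D t := fun t => by positivity
  have hr : ∀ t, 0 < r t := fun t => mul_pos (by positivity) (hD t)
  have hrD : ∀ t, r t ≤ D t := fun t => by
    have := hD t
    simp only [r]; nlinarith
  have hDs : ∀ t, D (t+1) = D t / 2 := fun t => by simp only [D]; rw [pow_succ]; field_simp
  obtain ⟨N, hNs, hNP, hsep, hcov⟩ := exists_nets P d r (fun t => (hr t).le)
    (fun t => by simp only [r, hDs]; have := hr t; simp only [r] at this; linarith) dself dcomm
  have hmono : Monotone N := monotone_nat_of_le_succ hNs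
  choose! π hπN hπ using hcov
  have hππ : ∀ t, ∀ p ∈ N t, π t p = p := by
    intro t p hp
    by_contra hne
    have h1 := hsep t p hp (π t p) (hπN t p (hNP t hp)) (Ne.symm hne)
    linarith [hπ t p (hNP t hp)]
  let cell : ℕ → E2 → Set E2 := fun t p => {x | x ∈ P ∧ π t x = p}
  let F : ℕ → Finset (E2 × E2) := fun t =>
    (N t ×ˢ N t).filter (fun z => D t / 2 ≤ d z.1 z.2 ∧ d z.1 z.2 ≤ 4 * D t)
  have hFm : ∀ t z, z ∈ F t ↔ (z.1 ∈ N t ∧ z.2 ∈ N t) ∧ (D t / 2 ≤ d z.1 z.2 ∧ d z.1 z.2 ≤ 4 * D t) := by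
    intro t z
    simp only [F, Finset.mem_filter, Finset.mem_product]
  have hFne : ∀ t, ∀ z ∈ F t, z.1 ≠ z.2 := by
    intro t z hz he
    have h := (hFm t z).1 hz
    have h2 := h.2.1
    rw [he, dself _ (hNP t h.1.2)] at h2
    linarith [hD t]
  -- levels covering each pair
  have hlev : ∀ x ∈ P, ∀ y ∈ P, x ≠ y → ∃ t, D t ≤ d x y ∧ d x y < 2 * D t := by
    intro x hx y hy hne
    have hpos : 0 < d x y := (dist_pos.2 hne).trans_le (dist_le_dG hP hx hy)
    have hex : ∃ t, D t ≤ d x y := by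
      obtain ⟨t, ht⟩ := pow_unbounded_of_one_lt (2 ^ L / d x y) (one_lt_two (α := ℝ))
      refine ⟨t, ?_⟩
      simp only [D]
      rw [div_lt_iff₀ hpos] at ht
      rw [div_le_iff₀ (by positivity)]
      linarith
    refine ⟨Nat.find hex, Nat.find_spec hex, ?_⟩
    rcases Nat.eq_zero_or_eq_succ_pred (Nat.find hex) with h0 | h0
    · rw [h0]
      have h1 : d x y < 2 * P.card := dG_lt P hP hx hy
      have h2 : (P.card : ℝ) ≤ 2 ^ L := by exact_mod_cast hL
      simp only [D, pow_zero, div_one]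
      linarith
    · have := Nat.find_min hex (m := (Nat.find hex).pred) (by omega)
      rw [h0, Nat.succ_eq_add_one, hDs]
      push Not at this
      linarith
  choose! lev hlev1 hlev2 using hlev
  let T : ℕ := (P ×ˢ P).sup (fun z => lev z.1 z.2) + 1
  let W : Finset (Set E2 × Set E2) := (Finset.range T).biUnion
    (fun t => (F t).image (fun z => (cell t z.1, cell t z.2)))
  refine ⟨W, ⟨?_, ?_⟩, ?_⟩
  · intro pr hpr
    simp only [W, Finset.mem_biUnion, Finset.mem_image] at hpr
    obtain ⟨t, -, ⟨p, q⟩, hz, rfl⟩ := hpr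
    have hne := hFne t _ hz
    obtain ⟨⟨hp, hq⟩, hl, hu⟩ := (hFm t _).1 hz
    simp only at hne hp hq hl hu
    have hDt := hD t
    have hcne : ∀ p ∈ N t, (cell t p).Nonempty := fun p hp => ⟨p, hNP t hp, hππ t p hp⟩
    have hdiam : ∀ p ∈ N t, ∀ a ∈ cell t p, ∀ b ∈ cell t p, d a b ≤ 2 * r t := by
      rintro p hp a ⟨ha, rfl⟩ b ⟨hb, hab⟩
      have h1 := hπ t a ha
      have h2 := hπ t b hb
      have h3 := dtri a ha (π t a) (hNP t hp) b hb
      rw [hab, dcomm] at h2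
      linarith
    refine ⟨fun x hx => hx.1, fun x hx => hx.1, hcne p hp, hcne q hq, ?_, ?_⟩
    · rw [Set.disjoint_left]
      rintro x ⟨_, hx⟩ ⟨_, hx'⟩
      exact hne (hx.symm.trans hx')
    · apply wellSep_of _ _ _ _ (hcne p hp) (hcne q hq) (2 * r t) (D t / 4) hε
        (hdiam p hp) (hdiam q hq)
      · rintro a ⟨ha, rfl⟩ b ⟨hb, rfl⟩
        have h1 := hπ t a ha
        have h2 := hπ t b hb
        have h3 := dtri (π t a) (hNP t hp) a ha (π t b) (hNP t hq)
        have h4 := dtri a ha b hb (π t b) (hNP t hq)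
        rw [dcomm] at h1
        have h5 : 2 * r t ≤ D t / 4 := by simp only [r]; nlinarith
        change D t / 4 ≤ d a b
        linarith
      · simp only [r]; linarith
  · intro x hx y hy hne
    have hl := hlev1 x hx y hy hne
    have hu := hlev2 x hx y hy hne
    set t := lev x y with ht
    have htT : t < T := Nat.lt_succ_of_le
      (Finset.le_sup (f := fun z : E2 × E2 => lev z.1 z.2) (b := (x, y))
        (Finset.mem_product.2 ⟨hx, hy⟩))
    refine ⟨(cell t (π t x), cell t (π t y)), ?_, Or.inl ⟨⟨hx, rfl⟩, ⟨hy, rfl⟩⟩⟩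
    simp only [W, Finset.mem_biUnion, Finset.mem_image]
    refine ⟨t, Finset.mem_range.2 htT, (π t x, π t y), ?_, rfl⟩
    have hpx := hπN t x hx
    have hpy := hπN t y hy
    have h1 := hπ t x hx
    have h2 := hπ t y hy
    have hDt := hD t
    have h5 : 2 * r t ≤ D t / 4 := by simp only [r]; nlinarith
    have h3 := dtri (π t x) (hNP t hpx) x hx (π t y) (hNP t hpy)
    have h4 := dtri x hx y hy (π t y) (hNP t hpy)
    have h6 := dtri x hx (π t x) (hNP t hpx) y hy
    have h7 := dtri (π t x) (hNP t hpx) (π t y) (hNP t hpy) y hy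
    rw [dcomm (π t x) x] at h3
    rw [dcomm (π t y) y] at h7
    refine (hFm t _).2 ⟨⟨hpx, hpy⟩, ?_, ?_⟩
    · change D t / 2 ≤ d (π t x) (π t y)
      linarith
    · change d (π t x) (π t y) ≤ 4 * D t
      linarith
  · let A : ℕ → Finset E2 := fun t => (N t).filter (fun p => L + 5 ≤ t → p ∉ N (t - (L + 5)))
    have hratio : ∀ t, D t / r t = 8 / ε := by
      intro t
      have := hD t
      simp only [r]
      field_simp
    have hlevel : ∀ t, ((F t).card : ℝ) ≤
        (if t < L then 705600 * P.card * (8 / ε) ^ 2 else 0)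
          + 225792 * (A t).card * (8 / ε) ^ 2 := by
      intro t
      by_cases h12 : 12 ≤ r t
      · have htL : t < L := by
          by_contra! hc
          have : D t ≤ 1 := by
            simp only [D]
            rw [div_le_one (by positivity)]
            exact pow_le_pow_right₀ one_le_two hc
          linarith [hrD t]
        rw [if_pos htL]
        have := large_level P hP (N t) (hNP t) (r t) (D t) h12 (hrD t) (hsep t) (F t) (by
          intro z hz
          have h := (hFm t z).1 hz
          exact ⟨h.1.1, h.1.2, hFne t z hz, h.2.2⟩)
        rw [hratio] at this
        have h0 : 0 ≤ 225792 * ((A t).card : ℝ) * (8 / ε) ^ 2 := by positivity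
        linarith
      · push Not at h12
        have := small_level P hP (N t) (hNP t) (r t) (D t) (hr t) h12.le (hrD t) (hsep t)
          (A t) (Finset.filter_subset _ _) (F t) (by
          intro z hz
          have h := (hFm t z).1 hz
          refine ⟨h.1.1, h.1.2, ?_, h.2.2⟩
          by_contra! hc
          simp only [A, Finset.mem_filter, not_and, Classical.not_imp, not_not] at hc
          obtain ⟨hLt, h1⟩ := hc.1 h.1.1
          obtain ⟨-, h2⟩ := hc.2 h.1.2
          have h3 := hsep _ _ h1 _ h2 (hFne t z hz)
          have h4 : r (t - (L + 5)) = 4 * D t * (ε * 2 ^ L) := by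
            obtain ⟨s, rfl⟩ := Nat.exists_eq_add_of_le hLt
            rw [Nat.add_sub_cancel_left]
            simp only [r, D]
            rw [pow_add _ (L + 5) s, pow_add _ L 5]
            field_simp
            norm_num
          rw [h4] at h3
          have := hD t
          have h5 := h.2.2
          nlinarith)
        rw [hratio] at this
        have h0 : (0 : ℝ) ≤ (if t < L then 705600 * P.card * (8 / ε) ^ 2 else 0) := by
          split_ifs <;> positivity
        linarith
    have hW : (W.card : ℝ) ≤ ∑ t ∈ Finset.range T, ((F t).card : ℝ) := by
      have : W.card ≤ ∑ t ∈ Finset.range T, (F t).card :=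
        Finset.card_biUnion_le.trans (Finset.sum_le_sum fun t _ => Finset.card_image_le)
      exact_mod_cast this
    refine hW.trans ((Finset.sum_le_sum fun t _ => hlevel t).trans ?_)
    rw [Finset.sum_add_distrib]
    refine add_le_add ?_ ?_
    · rw [← Finset.sum_filter, Finset.sum_const, nsmul_eq_mul]
      have hc : ((Finset.range T).filter (fun t => t < L)).card ≤ L := by
        have : (Finset.range T).filter (fun t => t < L) ⊆ Finset.range L := by
          intro t ht
          rw [Finset.mem_filter] at ht
          exact Finset.mem_range.2 ht.2
        simpa using Finset.card_le_card this
      have hc' : (((Finset.range T).filter (fun t => t < L)).card : ℝ) ≤ L := by exact_mod_cast hc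
      gcongr
    · rw [← Finset.sum_mul, ← Finset.mul_sum]
      have h := sum_levels P N hmono hNP (L + 5) T
      have h' : ∑ t ∈ Finset.range T, ((A t).card : ℝ) ≤ ((L + 5 : ℕ) : ℝ) * P.card := by
        exact_mod_cast h
      gcongr

end Packing

end WSPDAux

/-- **WSPD for weighted unit-distance graphs in the plane.** There is a universal
constant `c > 0` such that every connected weighted unit-distance graph on `n ≥ 2`
points in the plane admits, for every `ε ∈ (0,1)`, a `(1/ε)`-WSPD with respect to the
shortest-path metric of size at most `c·ε⁻²·n·log₂ n`. -/
theorem wspd_unit_distance_plane :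
    ∃ c : ℝ, 0 < c ∧
      ∀ ε : ℝ, 0 < ε → ε < 1 →
      ∀ P : Set (EuclideanSpace ℝ (Fin 2)), P.Finite → 2 ≤ P.ncard → UDConnected P →
        ∃ W : Finset (Set (EuclideanSpace ℝ (Fin 2)) × Set (EuclideanSpace ℝ (Fin 2))),
          IsWSPDG P (1 / ε) W ∧
          (W.card : ℝ) ≤ c * ε⁻¹ ^ 2 * (P.ncard : ℝ) * Real.logb 2 (P.ncard : ℝ) := by
  refine ⟨10 ^ 9, by positivity, ?_⟩
  intro ε hε hε1 P hfin hcard hconn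
  obtain ⟨Q, rfl⟩ : ∃ Q : Finset (EuclideanSpace ℝ (Fin 2)), P = ↑Q :=
    ⟨hfin.toFinset, by simp⟩
  rw [Set.ncard_coe_finset] at hcard ⊢
  have hn2 : (2 : ℝ) ≤ Q.card := by exact_mod_cast hcard
  have hlog : 1 ≤ Real.logb 2 (Q.card : ℝ) := by
    rw [Real.le_logb_iff_rpow_le one_lt_two (by linarith)]
    simpa using hn2
  have hinv : 1 ≤ ε⁻¹ := (one_le_inv₀ hε).2 hε1.le
  by_cases hcase : (Q.card : ℝ) ≤ ε⁻¹
  · obtain ⟨W, hW, hWc⟩ := WSPDAux.trivial_case Q hconn ε hε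
    refine ⟨W, hW, ?_⟩
    have h1 : (W.card : ℝ) ≤ Q.card * Q.card := by exact_mod_cast hWc
    have h2 : (Q.card : ℝ) * Q.card ≤ ε⁻¹ ^ 2 * Q.card := by
      gcongr
      nlinarith
    have h3 : 0 ≤ ε⁻¹ ^ 2 * (Q.card : ℝ) := by positivity
    nlinarith
  · push Not at hcase
    have hL : Q.card ≤ 2 ^ Nat.clog 2 Q.card := Nat.le_pow_clog one_lt_two _
    have hLR : (Q.card : ℝ) ≤ 2 ^ Nat.clog 2 Q.card := by exact_mod_cast hL
    have hL1 : 1 ≤ Nat.clog 2 Q.card := Nat.clog_pos one_lt_two hcard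
    have hL2 : (Nat.clog 2 Q.card : ℝ) ≤ 2 * Real.logb 2 Q.card := by
      have h := Nat.pow_pred_clog_lt_self one_lt_two (show 1 < Q.card by omega)
      have h' : (2 : ℝ) ^ ((Nat.clog 2 Q.card).pred : ℝ) ≤ Q.card := by
        rw [Real.rpow_natCast]
        exact_mod_cast h.le
      rw [← Real.le_logb_iff_rpow_le one_lt_two (by linarith)] at h'
      have h2 : (((Nat.clog 2 Q.card).pred : ℕ) : ℝ) + 1 = (Nat.clog 2 Q.card : ℝ) := by
        exact_mod_cast Nat.succ_pred_eq_of_pos hL1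
      linarith
    generalize Nat.clog 2 Q.card = L at *
    have hεL : 1 ≤ ε * 2 ^ L := by
      have h : ε⁻¹ ≤ 2 ^ L := hcase.le.trans hLR
      rwa [inv_le_iff_one_le_mul₀' hε] at h
    obtain ⟨W, hW, hWc⟩ := WSPDAux.main_case Q hconn ε hε hε1 L hL hεL
    refine ⟨W, hW, hWc.trans ?_⟩
    have e : (8 / ε) = 8 * ε⁻¹ := by rw [div_eq_mul_inv]
    rw [e]
    set X : ℝ := ε⁻¹ ^ 2 * Q.card with hX
    have hX0 : 0 ≤ X := by positivity
    have hL1' : (1 : ℝ) ≤ L := by exact_mod_cast hL1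
    push_cast
    calc (L : ℝ) * (705600 * Q.card * (8 * ε⁻¹) ^ 2)
          + 225792 * (((L : ℝ) + 5) * Q.card) * (8 * ε⁻¹) ^ 2
        = X * (64 * (705600 * L + 225792 * (L + 5))) := by rw [hX]; ring
      _ ≤ X * (10 ^ 9 * Real.logb 2 Q.card) := by
          apply mul_le_mul_of_nonneg_left _ hX0
          linarith
      _ = _ := by rw [hX]; ring
end

section
/- Let (U, d_U) and (X, d_X) be metric spaces, let P ⊆ U be a finite set with at least two points, let f : P → X be any map, and let ε ∈ (0,1). Let W be an (8/ε)-WSPD of P with respect to d_U, and for each pair {A, B} ∈ W fix representatives rep(A) ∈ A and rep(B) ∈ B. Define ℓ = max_{{A,B}∈W} d_X(f(rep(A)), f(rep(B))) / d_U(rep(A), rep(B)) and L = max_{x,y∈P, x≠y} d_X(f(x), f(y)) / d_U(x, y) (the dilation of f). Then (1 − ε)·L ≤ ℓ ≤ L. -/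
open Metric Set

variable {U : Type*} [MetricSpace U] {X : Type*} [MetricSpace X]

/-- **Approximating the dilation via WSPD.** Given an `(8/ε)`-WSPD `W` of a finite set
`P` with at least two points and representatives `rep(A) ∈ A`, `rep(B) ∈ B` for each
pair `{A,B} ∈ W`, the quantity
`ℓ = max_{{A,B} ∈ W} d_X(f(rep A), f(rep B)) / d_U(rep A, rep B)` satisfies
`(1−ε)·L ≤ ℓ ≤ L`, where `L = max_{x ≠ y ∈ P} d_X(f x, f y)/d_U(x,y)` is the dilation
of `f`. -/
theorem wspd_approximates_dilation
    (P : Set U) (hPfin : P.Finite) (hP2 : 2 ≤ P.ncard)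
    (f : U → X) (ε : ℝ) (hε0 : 0 < ε) (hε1 : ε < 1)
    (W : Finset (Set U × Set U)) (hW : IsWSPD (8 / ε) P W)
    (repA repB : Set U × Set U → U)
    (hrep : ∀ pr ∈ W, repA pr ∈ pr.1 ∧ repB pr ∈ pr.2) :
    (1 - ε) * sSup {t | ∃ x ∈ P, ∃ y ∈ P, x ≠ y ∧ t = dist (f x) (f y) / dist x y} ≤
      sSup {t | ∃ pr ∈ W, t = dist (f (repA pr)) (f (repB pr)) / dist (repA pr) (repB pr)} ∧
    sSup {t | ∃ pr ∈ W, t = dist (f (repA pr)) (f (repB pr)) / dist (repA pr) (repB pr)} ≤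
      sSup {t | ∃ x ∈ P, ∃ y ∈ P, x ≠ y ∧ t = dist (f x) (f y) / dist x y} := by
  obtain ⟨hW1, hW2⟩ := hW
  set S := {t | ∃ x ∈ P, ∃ y ∈ P, x ≠ y ∧ t = dist (f x) (f y) / dist x y} with hS
  set T := {t | ∃ pr ∈ W, t = dist (f (repA pr)) (f (repB pr)) / dist (repA pr) (repB pr)} with hT
  have hSfin : S.Finite := by
    refine ((hPfin.prod hPfin).image
      (fun p : U × U => dist (f p.1) (f p.2) / dist p.1 p.2)).subset ?_
    rintro t ⟨x, hx, y, hy, -, rfl⟩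
    exact ⟨(x, y), ⟨hx, hy⟩, rfl⟩
  have hSne : S.Nonempty := by
    obtain ⟨x, hx, y, hy, hxy⟩ := (Set.one_lt_ncard hPfin).1 (by omega : 1 < P.ncard)
    exact ⟨_, x, hx, y, hy, hxy, rfl⟩
  have hTS : T ⊆ S := by
    rintro t ⟨pr, hpr, rfl⟩
    obtain ⟨h1, h2, -, -, hd, -⟩ := hW1 pr hpr
    obtain ⟨ha, hb⟩ := hrep pr hpr
    exact ⟨_, h1 ha, _, h2 hb, hd.ne_of_mem ha hb, rfl⟩
  have hLS : sSup S ∈ S := hSne.csSup_mem hSfin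
  have hTne : T.Nonempty := by
    obtain ⟨x, hx, y, hy, hxy, -⟩ := hLS
    obtain ⟨pr, hpr, -⟩ := hW2 x hx y hy hxy
    exact ⟨_, pr, hpr, rfl⟩
  have hTb : BddAbove T := hSfin.bddAbove.mono hTS
  refine ⟨?_, csSup_le_csSup hSfin.bddAbove hTne hTS⟩
  have hL0 : 0 ≤ sSup S := by
    obtain ⟨x, hx, y, hy, hxy, h⟩ := hLS
    rw [h]; positivity
  have hl0 : 0 ≤ sSup T := by
    obtain ⟨t, ht⟩ := hTne
    refine le_trans ?_ (le_csSup hTb ht)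
    obtain ⟨pr, hpr, rfl⟩ := ht
    positivity
  have hlip : ∀ x ∈ P, ∀ y ∈ P, dist (f x) (f y) ≤ sSup S * dist x y := by
    intro x hx y hy
    by_cases hxy : x = y
    · simp [hxy]
    · rw [← div_le_iff₀ (dist_pos.2 hxy)]
      exact le_csSup hSfin.bddAbove ⟨x, hx, y, hy, hxy, rfl⟩
  have key : ∀ pr ∈ W, ∀ x ∈ pr.1, ∀ y ∈ pr.2,
      dist (f x) (f y) ≤ sSup S * (ε / 4 * dist x y) + sSup T * ((1 + ε / 4) * dist x y) := by
    intro pr hpr x hx y hy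
    obtain ⟨h1, h2, -, -, hd, hsep⟩ := hW1 pr hpr
    obtain ⟨ha, hb⟩ := hrep pr hpr
    have hds : distSets pr.1 pr.2 ≤ dist x y := by
      refine csInf_le ⟨0, ?_⟩ ⟨x, hx, y, hy, rfl⟩
      rintro t ⟨a, -, b, -, rfl⟩
      exact dist_nonneg
    have hm : max (Metric.diam pr.1) (Metric.diam pr.2) ≤ ε / 8 * dist x y := by
      refine le_trans hsep ?_
      rw [one_div_div]
      gcongr
    have hxa : dist x (repA pr) ≤ ε / 8 * dist x y :=
      (Metric.dist_le_diam_of_mem (hPfin.subset h1).isBounded hx ha).trans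
        ((le_max_left _ _).trans hm)
    have hby : dist (repB pr) y ≤ ε / 8 * dist x y :=
      (Metric.dist_le_diam_of_mem (hPfin.subset h2).isBounded hb hy).trans
        ((le_max_right _ _).trans hm)
    have hab : dist (repA pr) (repB pr) ≤ (1 + ε / 4) * dist x y := by
      have := dist_triangle4 (repA pr) x y (repB pr)
      rw [dist_comm (repA pr) x, dist_comm y] at this
      linarith
    have hfab : dist (f (repA pr)) (f (repB pr)) ≤ sSup T * dist (repA pr) (repB pr) := by
      rw [← div_le_iff₀ (dist_pos.2 (hd.ne_of_mem ha hb))]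
      exact le_csSup hTb ⟨pr, hpr, rfl⟩
    have e1 := hlip x (h1 hx) _ (h1 ha)
    have e2 := hlip _ (h2 hb) y (h2 hy)
    have e3 := dist_triangle4 (f x) (f (repA pr)) (f (repB pr)) (f y)
    have e4 := mul_le_mul_of_nonneg_left hxa hL0
    have e5 := mul_le_mul_of_nonneg_left hby hL0
    have e6 := mul_le_mul_of_nonneg_left hab hl0
    linarith
  have main : sSup S ≤ sSup S * (ε / 4) + sSup T * (1 + ε / 4) := by
    obtain ⟨x, hx, y, hy, hxy, h⟩ := hLS
    have hp := dist_pos.2 hxy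
    have hk : dist (f x) (f y) ≤
        sSup S * (ε / 4 * dist x y) + sSup T * ((1 + ε / 4) * dist x y) := by
      obtain ⟨pr, hpr, ⟨h1, h2⟩ | ⟨h1, h2⟩⟩ := hW2 x hx y hy hxy
      · exact key pr hpr x h1 y h2
      · rw [dist_comm (f x), dist_comm x]
        exact key pr hpr y h2 x h1
    refine h.le.trans ?_
    rw [div_le_iff₀ hp]
    linarith
  generalize sSup S = L at *
  generalize sSup T = l at *
  have h3 : (1 - ε) * L * (1 + ε / 4) ≤ l * (1 + ε / 4) := by
    nlinarith [mul_nonneg hL0 hε0.le, mul_nonneg hL0 (sq_nonneg ε)]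
  exact le_of_mul_le_mul_right h3 (by positivity)
end
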